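/- arXiv:1411.5083 — 3 statements merged into one kernel-verified Lean document; each statement's English description precedes it below -/
import Mathlib

section
/- (Exact composition with the horizontal derivative.) Let σ : ℍ^{d+1} × ℝ^{d+1} → ℂ be smooth, Λ-periodic in θ, and satisfy: for all multi-indices α (in ξ), β (in x) and every M ≥ 0 there is C with |∂_x^β ∂_ξ^α σ(x,ξ)| ≤ C y^{|β|−|α|} (1 + y|ξ|)^{-M}. Then for every h > 0 and 1 ≤ i ≤ d, as operators on C_c^∞(Z_Λ): (h y ∂_{θ_i}) ∘ Op_h(σ) = Op_h(σ_θ), where σ_θ(x,ξ) = i y J_i σ(x,ξ) − (h/2) J_i ∂_Y σ(x,ξ) + (h/2) y ∂_{θ_i} σ(x,ξ) + i (h²/4) ∂_{θ_i} ∂_Y σ(x,ξ), with ξ = (Y,J). -/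
open MeasureTheory Real Filter
open scoped RealInnerProductSpace ENNReal NNReal Topology

noncomputable section

/-- Euclidean `d`-space `ℝᵈ`. -/
abbrev Ed (d : ℕ) := EuclideanSpace ℝ (Fin d)

/-- The Euclidean norm of a covector `ξ = (Y, J) ∈ ℝ × ℝᵈ`. -/
def xiNorm (d : ℕ) (ξ : ℝ × Ed d) : ℝ := Real.sqrt (ξ.1 ^ 2 + ‖ξ.2‖ ^ 2)

/-- The Euclidean pairing `⟨x, ξ⟩` on `ℝ^{1+d} = ℝ × ℝᵈ`. -/
def epair (d : ℕ) (x ξ : ℝ × Ed d) : ℝ := x.1 * ξ.1 + ⟪x.2, ξ.2⟫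

/-- The half-cylinder `(0,∞) × D`, where `D ⊆ ℝᵈ` is a fundamental domain for the
lattice `Λ`: a concrete model for the full cusp `Z_Λ`. -/
def cusp (d : ℕ) (D : Set (Ed d)) : Set (ℝ × Ed d) := Set.Ioi (0 : ℝ) ×ˢ D

/-- The density `y^{-(d+1)}` of the Riemannian volume of `Z_Λ` with respect to the
Lebesgue measure `dy dθ` of the half-cylinder. -/
def cuspWeight (d : ℕ) (x : ℝ × Ed d) : ℝ≥0∞ := ENNReal.ofReal (x.1 ^ (-((d : ℝ) + 1)))

/-- The semiclassical Weyl kernel `K^w_σ(x,x') = (2πh)^{-(d+1)} ∫ e^{i⟨x-x',ξ⟩/h} σ((x+x')/2, ξ) dξ`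
on the half-space `ℍ^{d+1}`. -/
def weylKernel (d : ℕ) (h : ℝ) (σ : (ℝ × Ed d) → (ℝ × Ed d) → ℂ) (x x' : ℝ × Ed d) : ℂ :=
  ((2 * π * h) ^ (d + 1))⁻¹ •
    ∫ ξ : ℝ × Ed d,
      Complex.exp (Complex.I * Complex.ofReal (epair d (x - x') ξ / h)) *
        σ ((1 / 2 : ℝ) • (x + x')) ξ

/-- The kernel `K_σ(x,x') = (y/y')^{(d+1)/2} ∑_{k∈Λ} K^w_σ(y,θ,y',θ'+k)` of the cusp
quantization, with respect to the Lebesgue measure `dy' dθ'` on the half-cylinder. -/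
def cuspKernel (d : ℕ) (Λ : AddSubgroup (Ed d)) (h : ℝ) (σ : (ℝ × Ed d) → (ℝ × Ed d) → ℂ)
    (x x' : ℝ × Ed d) : ℂ :=
  ((x.1 / x'.1) ^ (((d : ℝ) + 1) / 2)) • ∑' k : Λ, weylKernel d h σ x (x'.1, x'.2 + (k : Ed d))

/-- The cusp quantization `Op_h(σ)` as an integral operator on `Z_Λ`. -/
def cuspOp (d : ℕ) (Λ : AddSubgroup (Ed d)) (D : Set (Ed d)) (h : ℝ)
    (σ : (ℝ × Ed d) → (ℝ × Ed d) → ℂ) (f : ℝ × Ed d → ℂ) (x : ℝ × Ed d) : ℂ :=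
  ∫ x' in cusp d D, cuspKernel d Λ h σ x x' * f x'

section helpers
open scoped Pointwise

theorem aux_haar (d : ℕ) : (volume : Measure (ℝ × Ed d)).IsAddHaarMeasure := by
  rw [Measure.volume_eq_prod]; infer_instance

theorem aux_cover (d : ℕ) (Λ : AddSubgroup (Ed d)) (hΛ : DiscreteTopology Λ)
    (D : Set (Ed d)) (hD : IsAddFundamentalDomain Λ D volume) (hDvol : volume D = 1) :
    ∃ R : ℝ, ∀ θ : Ed d, ∃ k ∈ Λ, ‖θ + k‖ ≤ R := by
  have : Countable Λ := TopologicalSpace.separableSpace_iff_countable.1 inferInstance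
  obtain ⟨r, hr, hr'⟩ : ∃ r > 0, ∀ k ∈ Λ, k ≠ 0 → r ≤ ‖k‖ := by
    have h0 : ({0} : Set Λ) ∈ 𝓝 (0 : Λ) := by simp
    rw [Metric.mem_nhds_iff] at h0
    obtain ⟨r, hr, h⟩ := h0
    refine ⟨r, hr, fun k hk hk0 => ?_⟩
    by_contra! hlt
    have : (⟨k, hk⟩ : Λ) ∈ Metric.ball (0 : Λ) r := by
      simpa [Metric.mem_ball, Subtype.dist_eq] using hlt
    have := h this
    simp at this
    exact hk0 this
  by_contra! hcon
  obtain ⟨θ, -, hθ⟩ := exists_seq_of_forall_finset_exists (α := Ed d) (fun _ => True)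
    (fun a b => ∀ k ∈ Λ, r ≤ ‖b - a + k‖) (by
      intro s _
      obtain ⟨R, hR⟩ : ∃ R : ℝ, ∀ a ∈ s, ‖a‖ ≤ R :=
        ⟨∑ a ∈ s, ‖a‖, fun a ha => Finset.single_le_sum (fun b _ => norm_nonneg b) ha⟩
      obtain ⟨b, hb⟩ := hcon (R + r)
      refine ⟨b, trivial, fun a ha k hk => ?_⟩
      have h1 := hb k hk
      have h2 := hR a ha
      have h3 : ‖b + k‖ ≤ ‖b - a + k‖ + ‖a‖ := by
        have := norm_add_le (b - a + k) a
        rwa [show b - a + k + a = b + k by abel] at this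
      linarith)
  have key : ∀ m n, ∀ k ∈ Λ, (m ≠ n ∨ k ≠ 0) → r ≤ ‖θ m - θ n + k‖ := by
    intro m n k hk h
    rcases lt_trichotomy m n with hmn | hmn | hmn
    · have := hθ m n hmn (-k) (neg_mem hk)
      rw [← norm_neg] at this
      rwa [show -(θ n - θ m + -k) = θ m - θ n + k by abel] at this
    · subst hmn
      simpa using hr' k hk (by simpa using h)
    · exact hθ n m hmn k hk
  let s : Set (Ed d) := ⋃ n, Metric.ball (θ n) (r / 2)
  have hdisj : ∀ m n, ∀ k ∈ Λ, (m ≠ n ∨ k ≠ 0) → ∀ a ∈ Metric.ball (θ m) (r/2),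
      ∀ b ∈ Metric.ball (θ n) (r/2), a + k ≠ b := by
    intro m n k hk h a ha b hb hab
    have h1 := key m n k hk h
    rw [Metric.mem_ball, dist_eq_norm] at ha hb
    have h2 : θ m - θ n + k = (b - θ n) - (a - θ m) := by rw [← hab]; abel
    rw [h2] at h1
    have := norm_sub_le (b - θ n) (a - θ m)
    linarith
  have hs : volume s = ⊤ := by
    rw [measure_iUnion]
    · simp only [Measure.addHaar_ball_center]
      refine ENNReal.tsum_const_eq_top_of_ne_zero ?_
      exact (Metric.measure_ball_pos volume (0 : Ed d) (by positivity)).ne'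
    · intro m n hmn
      refine Set.disjoint_left.2 fun a ha hb => ?_
      exact hdisj m n 0 (zero_mem _) (Or.inl hmn) a ha a hb (by simp)
    · intro n; exact measurableSet_ball
  obtain ⟨x, y, hxy, hnd⟩ := exists_pair_mem_lattice_not_disjoint_vadd hD
    (s := s) (by exact (MeasurableSet.iUnion fun n => measurableSet_ball).nullMeasurableSet)
    (by rw [hs, hDvol]; simp)
  rw [Set.not_disjoint_iff] at hnd
  obtain ⟨z, ⟨a, ha, rfl⟩, ⟨b, hb, hab⟩⟩ := hnd
  simp only [s, Set.mem_iUnion] at ha hb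
  obtain ⟨m, ha⟩ := ha
  obtain ⟨n, hb⟩ := hb
  refine hdisj m n ((x : Ed d) - y) (sub_mem x.2 y.2) (Or.inr ?_) a ha b hb ?_
  · rw [sub_ne_zero]; exact fun h => hxy (Subtype.ext h)
  · have : (y : Ed d) + b = x + a := hab
    rw [← add_sub_assoc, add_comm a, ← this]; abel

/-- Unfolding. -/
theorem aux_unfold (d : ℕ) (Λ : AddSubgroup (Ed d)) (hΛ : DiscreteTopology Λ)
    (D : Set (Ed d)) (hD : IsAddFundamentalDomain Λ D volume) 
    (I : Set ℝ) (hI : MeasurableSet I) (Φ : ℝ × Ed d → ℂ)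
    (hΦ : IntegrableOn Φ (I ×ˢ Set.univ)) :
    ∫ x in I ×ˢ D, ∑' k : Λ, Φ (x.1, x.2 + k) = ∫ x in I ×ˢ (Set.univ : Set (Ed d)), Φ x := by
  have : Countable Λ := TopologicalSpace.separableSpace_iff_countable.1 inferInstance
  have := aux_haar d
  let s : Λ → Set (ℝ × Ed d) := fun k => I ×ˢ ((fun θ => θ + -(k : Ed d)) ⁻¹' D)
  have hsm : ∀ k, NullMeasurableSet (s k) volume := by
    intro k
    apply hI.nullMeasurableSet.prod
    exact hD.nullMeasurableSet.preimage
      (measurePreserving_add_right volume (-(k : Ed d))).quasiMeasurePreserving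
  have hset : ∀ k : Λ, ((fun θ => θ + -(k : Ed d)) ⁻¹' D) = k +ᵥ D := by
    intro k; ext θ
    rw [Set.mem_vadd_set_iff_neg_vadd_mem]
    simp only [Set.mem_preimage]
    have : (-k +ᵥ θ) = θ + -(k : Ed d) := by
      change ((-k : Λ) : Ed d) + θ = _
      push_cast; abel
    rw [this]
  have hsd : Pairwise (Function.onFun (AEDisjoint volume) s) := by
    intro k l hkl
    have h1 : volume ((k +ᵥ D) ∩ (l +ᵥ D)) = 0 := hD.aedisjoint hkl
    change volume (s k ∩ s l) = 0
    simp only [s, hset]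
    rw [Set.prod_inter_prod, Measure.volume_eq_prod, Measure.prod_prod, h1, mul_zero]
  have hcov : (⋃ k, s k : Set _) =ᵐ[volume] I ×ˢ (Set.univ : Set (Ed d)) := by
    have h1 : (⋃ k, s k) = I ×ˢ (⋃ k : Λ, k +ᵥ D) := by
      simp only [s, hset, Set.prod_iUnion]
    rw [h1]
    have h2 : (⋃ k : Λ, k +ᵥ D) =ᵐ[volume] (Set.univ : Set (Ed d)) := hD.iUnion_vadd_ae_eq
    rw [Measure.volume_eq_prod]
    exact Measure.set_prod_ae_eq (ae_eq_refl _) h2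
  have hΦ' : IntegrableOn Φ (⋃ k, s k) := hΦ.congr_set_ae hcov
  let T : Λ → ℝ × Ed d → ℝ × Ed d := fun k x => x + (0, (k : Ed d))
  have hT : ∀ k, MeasurePreserving (T k) volume volume := fun k =>
    measurePreserving_add_right volume _
  have hTe : ∀ k, MeasurableEmbedding (T k) := fun k =>
    measurableEmbedding_addRight _
  have hTs : ∀ k, T k ⁻¹' (s k) = I ×ˢ D := by
    intro k; ext x; simp [T, s]
  have hTx : ∀ k x, T k x = (x.1, x.2 + k) := by
    intro k x; simp [T, Prod.ext_iff]
  have hIntg : ∀ k : Λ, IntegrableOn (fun x : ℝ × Ed d => Φ (x.1, x.2 + k)) (I ×ˢ D) := by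
    intro k
    have := ((hT k).integrableOn_comp_preimage (hTe k) (f := Φ) (s := s k)).2
      (hΦ'.mono_set (Set.subset_iUnion s k))
    rw [hTs] at this
    simpa [Function.comp_def, hTx] using this
  have hval : ∀ (E : Type) [NormedAddCommGroup E] [NormedSpace ℝ E] (Ψ : ℝ × Ed d → E) (k : Λ),
      ∫ x in I ×ˢ D, Ψ (x.1, x.2 + k) = ∫ x in s k, Ψ x := by
    intro E _ _ Ψ k
    have := (hT k).setIntegral_preimage_emb (hTe k) Ψ (s k)
    rw [hTs] at this
    simpa [hTx] using this
  have h1 := hasSum_integral_of_summable_integral_norm (μ := volume.restrict (I ×ˢ D)) 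
    (F := fun (k : Λ) (x : ℝ × Ed d) => Φ (x.1, x.2 + k)) hIntg (by
      have := (hasSum_integral_iUnion_ae hsm hsd (f := fun x => ‖Φ x‖) hΦ'.norm).summable
      refine this.congr fun k => ?_
      exact (hval ℝ (fun x => ‖Φ x‖) k).symm)
  have h2 := hasSum_integral_iUnion_ae hsm hsd hΦ'
  rw [← setIntegral_congr_set hcov]
  refine h1.unique ?_
  convert! h2 using 2 with k
  exact hval ℂ Φ k

section comm
set_option linter.unusedSectionVars false
variable {X W E : Type} [NormedAddCommGroup X] [NormedSpace ℝ X]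
  [NormedAddCommGroup W] [NormedSpace ℝ W] [NormedAddCommGroup E] [NormedSpace ℝ E]

/-- Joint smoothness on `s × W`. -/
def Sm (s : Set X) (g : X → W → E) : Prop :=
  ContDiffOn ℝ (⊤ : ℕ∞) (fun p : X × W => g p.1 p.2) {p | p.1 ∈ s}

/-- Partial derivative in the first variable. -/
def PD (g : X → W → E) (z : X) (ξ : W) : X →L[ℝ] E := fderiv ℝ (fun u => g u ξ) z

/-- Partial derivative in the second variable. -/
def QD (g : X → W → E) (z : X) (ξ : W) : W →L[ℝ] E := fderiv ℝ (g z) ξ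

theorem Sm.isOpen {s : Set X} (hs : IsOpen s) : IsOpen {p : X × W | p.1 ∈ s} :=
  hs.preimage continuous_fst

theorem Sm.contDiffAt {s : Set X} (hs : IsOpen s) {g : X → W → E} (hg : Sm s g) {p : X × W}
    (hp : p.1 ∈ s) : ContDiffAt ℝ (⊤ : ℕ∞) (fun p : X × W => g p.1 p.2) p :=
  ContDiffOn.contDiffAt hg ((Sm.isOpen hs).mem_nhds hp)

theorem Sm.hasFDerivAt {s : Set X} (hs : IsOpen s) {g : X → W → E} (hg : Sm s g) {p : X × W}
    (hp : p.1 ∈ s) : HasFDerivAt (fun p : X × W => g p.1 p.2)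
      (fderiv ℝ (fun p : X × W => g p.1 p.2) p) p :=
  ((hg.contDiffAt hs hp).differentiableAt (by simp)).hasFDerivAt

theorem Sm.hasP {s : Set X} (hs : IsOpen s) {g : X → W → E} (hg : Sm s g) {z : X} (ξ : W)
    (hz : z ∈ s) : HasFDerivAt (fun u => g u ξ)
      ((fderiv ℝ (fun p : X × W => g p.1 p.2) (z, ξ)).comp (ContinuousLinearMap.inl ℝ X W)) z :=
  HasFDerivAt.comp (f := fun e : X => (e, ξ)) z (hg.hasFDerivAt hs (p := (z, ξ)) hz)
    (hasFDerivAt_prodMk_left (𝕜 := ℝ) z ξ)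

theorem Sm.hasQ {s : Set X} (hs : IsOpen s) {g : X → W → E} (hg : Sm s g) {z : X} (ξ : W)
    (hz : z ∈ s) : HasFDerivAt (g z)
      ((fderiv ℝ (fun p : X × W => g p.1 p.2) (z, ξ)).comp (ContinuousLinearMap.inr ℝ X W)) ξ :=
  (hg.hasFDerivAt hs (p := (z, ξ)) hz).comp ξ (hasFDerivAt_prodMk_right z ξ)

theorem Sm.contDiff {s : Set X} (hs : IsOpen s) {g : X → W → E} (hg : Sm s g) {z : X}
    (hz : z ∈ s) : ContDiff ℝ (⊤ : ℕ∞) (g z) := by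
  rw [contDiff_iff_contDiffAt]
  intro ξ
  have h1 : ContDiffAt ℝ (⊤ : ℕ∞) (fun ξ : W => (z, ξ)) ξ := by fun_prop
  exact (hg.contDiffAt hs (p := (z, ξ)) hz).comp ξ h1

theorem Sm.fderiv_joint {s : Set X} (hs : IsOpen s) {g : X → W → E} (hg : Sm s g) :
    ContDiffOn ℝ (⊤ : ℕ∞) (fderiv ℝ (fun p : X × W => g p.1 p.2)) {p | p.1 ∈ s} :=
  ContDiffOn.fderiv_of_isOpen hg (Sm.isOpen hs) (by simp)

theorem Sm.P {s : Set X} (hs : IsOpen s) {g : X → W → E} (hg : Sm s g) : Sm s (PD g) := by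
  have h := (hg.fderiv_joint hs).clm_comp (contDiffOn_const (c := ContinuousLinearMap.inl ℝ X W))
  refine ContDiffOn.congr h fun p hp => ?_
  exact (hg.hasP hs p.2 hp).fderiv

theorem Sm.Q {s : Set X} (hs : IsOpen s) {g : X → W → E} (hg : Sm s g) : Sm s (QD g) := by
  have h := (hg.fderiv_joint hs).clm_comp (contDiffOn_const (c := ContinuousLinearMap.inr ℝ X W))
  refine ContDiffOn.congr h fun p hp => ?_
  exact (hg.hasQ hs p.2 hp).fderiv

theorem Sm.comm {s : Set X} (hs : IsOpen s) {g : X → W → E} (hg : Sm s g) {z : X} (ξ : W)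
    (hz : z ∈ s) : QD (PD g) z ξ = (PD (QD g) z ξ).flip := by
  set F := fun p : X × W => g p.1 p.2 with hF
  have hD : HasFDerivAt (fderiv ℝ F) (fderiv ℝ (fderiv ℝ F) (z, ξ)) (z, ξ) := by
    have h1 := (hg.fderiv_joint hs).contDiffAt ((Sm.isOpen hs).mem_nhds (x := (z, ξ)) hz)
    exact (h1.differentiableAt (by simp)).hasFDerivAt
  have hsymm : IsSymmSndFDerivAt ℝ F (z, ξ) :=
    (hg.contDiffAt hs (p := (z, ξ)) hz).isSymmSndFDerivAt (by
      simp only [minSmoothness_of_isRCLikeNormedField]; exact WithTop.coe_le_coe.2 le_top)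
  have e1 : ∀ a b, QD (PD g) z ξ b a = fderiv ℝ (fderiv ℝ F) (z, ξ) (0, b) (a, 0) := by
    intro a b
    have h1 : PD g z = fun ξ => (fderiv ℝ F (z, ξ)).comp (ContinuousLinearMap.inl ℝ X W) := by
      funext η; exact (hg.hasP hs η hz).fderiv
    have h2 := (hD.comp ξ (hasFDerivAt_prodMk_right z ξ)).clm_comp
      (hasFDerivAt_const (ContinuousLinearMap.inl ℝ X W) ξ)
    rw [QD, h1]
    erw [h2.fderiv]
    simp
  have e2 : ∀ a b, PD (QD g) z ξ a b = fderiv ℝ (fderiv ℝ F) (z, ξ) (a, 0) (0, b) := by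
    intro a b
    have h1 : (fun u => QD g u ξ) =ᶠ[𝓝 z]
        fun u => (fderiv ℝ F (u, ξ)).comp (ContinuousLinearMap.inr ℝ X W) := by
      filter_upwards [hs.mem_nhds hz] with u hu
      exact (hg.hasQ hs ξ hu).fderiv
    have h2 := (HasFDerivAt.comp (f := fun e : X => (e, ξ)) z hD
      (hasFDerivAt_prodMk_left (𝕜 := ℝ) z ξ)).clm_comp
      (hasFDerivAt_const (ContinuousLinearMap.inr ℝ X W) z)
    rw [PD, h1.fderiv_eq]
    erw [h2.fderiv]
    simp
  ext b a
  rw [ContinuousLinearMap.flip_apply, e1, e2]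
  exact hsymm _ _

end comm

theorem norm_fderiv_isom {X F G : Type} [NormedAddCommGroup X] [NormedSpace ℝ X]
    [NormedAddCommGroup F] [NormedSpace ℝ F] [NormedAddCommGroup G] [NormedSpace ℝ G]
    (e : F ≃L[ℝ] G) (he : ∀ x, ‖e x‖ = ‖x‖) (f : X → F) (z : X) :
    ‖fderiv ℝ (fun u => e (f u)) z‖ = ‖fderiv ℝ f z‖ := by
  have := e.comp_fderiv (f := f) (x := z)
  simp only [Function.comp_def] at this
  rw [this]
  apply le_antisymm
  · refine ContinuousLinearMap.opNorm_le_bound _ (norm_nonneg _) fun x => ?_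
    simp only [ContinuousLinearMap.comp_apply, ContinuousLinearEquiv.coe_coe, he]
    exact ContinuousLinearMap.le_opNorm _ _
  · refine ContinuousLinearMap.opNorm_le_bound _ (norm_nonneg _) fun x => ?_
    rw [← he]
    exact ContinuousLinearMap.le_opNorm ((e : F →L[ℝ] G).comp (fderiv ℝ f z)) x

def eC (W E : Type)  [NormedAddCommGroup W] [NormedSpace ℝ W] [NormedAddCommGroup E] [NormedSpace ℝ E] (n : ℕ) : (W [×n]→L[ℝ] W →L[ℝ] E) ≃L[ℝ] (W [×(n+1)]→L[ℝ] E) :=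
  (continuousMultilinearCurryRightEquiv' ℝ n W E).symm.toContinuousLinearEquiv
theorem eC_norm {W E : Type} [NormedAddCommGroup W] [NormedSpace ℝ W]
    [NormedAddCommGroup E] [NormedSpace ℝ E] (n : ℕ) (x : W [×n]→L[ℝ] W →L[ℝ] E) : ‖eC W E n x‖ = ‖x‖ := 
  (continuousMultilinearCurryRightEquiv' ℝ n W E).symm.norm_map x
theorem eC_it {W E : Type} [NormedAddCommGroup W] [NormedSpace ℝ W]
    [NormedAddCommGroup E] [NormedSpace ℝ E] (n : ℕ) (f : W → E) (ξ : W) : iteratedFDeriv ℝ (n + 1) f ξ = eC W E n (iteratedFDeriv ℝ n (fderiv ℝ f) ξ) :=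
  iteratedFDeriv_succ_eq_comp_right

theorem eC_exists (W E : Type) [NormedAddCommGroup W] [NormedSpace ℝ W]
    [NormedAddCommGroup E] [NormedSpace ℝ E] (n : ℕ) :
    ∃ e : (W [×n]→L[ℝ] W →L[ℝ] E) ≃L[ℝ] (W [×(n+1)]→L[ℝ] E), (∀ x, ‖e x‖ = ‖x‖) ∧
      ∀ (f : W → E) (ξ : W),
        iteratedFDeriv ℝ (n + 1) f ξ = e (iteratedFDeriv ℝ n (fderiv ℝ f) ξ) :=
  ⟨eC W E n, fun x => eC_norm n x, fun f ξ => eC_it n f ξ⟩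

theorem Sm.norm_iter {X W : Type} [NormedAddCommGroup X] [NormedSpace ℝ X]
    [NormedAddCommGroup W] [NormedSpace ℝ W] {s : Set X} (hs : IsOpen s) (n : ℕ) :
    ∀ (E : Type) [NormedAddCommGroup E] [NormedSpace ℝ E] (g : X → W → E), Sm s g →
    ∀ z ∈ s, ∀ ξ : W, ‖iteratedFDeriv ℝ n (PD g z) ξ‖ =
      ‖fderiv ℝ (fun u => iteratedFDeriv ℝ n (g u) ξ) z‖ := by
  induction n with
  | zero =>
    intro E _ _ g hg z hz ξ
    rw [norm_iteratedFDeriv_zero]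
    simp only [iteratedFDeriv_zero_eq_comp, Function.comp_def]
    rw [PD]
    exact (norm_fderiv_isom (continuousMultilinearCurryFin0 ℝ W E).symm.toContinuousLinearEquiv
      (continuousMultilinearCurryFin0 ℝ W E).symm.norm_map (fun u => g u ξ) z).symm
  | succ n ih =>
    intro E _ _ g hg z hz ξ
    rw [← norm_iteratedFDeriv_fderiv]
    have h1 : fderiv ℝ (PD g z) = (ContinuousLinearMap.flipₗᵢ ℝ X W E) ∘ (PD (QD g) z) := by
      funext η
      exact hg.comm hs η hz
    have h2 := LinearIsometryEquiv.norm_iteratedFDeriv_comp_left (𝕜 := ℝ)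
      (F := X →L[ℝ] W →L[ℝ] E) (G := W →L[ℝ] X →L[ℝ] E)
      (ContinuousLinearMap.flipₗᵢ ℝ X W E) (PD (QD g) z) ξ n
    rw [h1, h2, ih _ _ (hg.Q hs) z hz ξ]
    obtain ⟨e, he, he'⟩ := eC_exists W E n
    simp only [he']
    have h3 := norm_fderiv_isom e he (fun u => iteratedFDeriv ℝ n (fderiv ℝ (g u)) ξ) z
    exact h3.symm

/-- The inner product as a bilinear map. -/
def innB (d : ℕ) : Ed d →L[ℝ] Ed d →L[ℝ] ℝ := innerSL ℝ

theorem innB_apply (d : ℕ) (v w : Ed d) : innB d v w = ⟪v, w⟫ := rfl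

/-- The bilinear form such that the Fourier character is the semiclassical phase. -/
def Lh (d : ℕ) (h : ℝ) : (ℝ × Ed d) →L[ℝ] (ℝ × Ed d) →L[ℝ] ℝ :=
  (-(2 * π * h)⁻¹) •
    ((ContinuousLinearMap.mul ℝ ℝ).bilinearComp (ContinuousLinearMap.fst ℝ ℝ (Ed d))
        (ContinuousLinearMap.fst ℝ ℝ (Ed d)) +
      (innB d).bilinearComp (ContinuousLinearMap.snd ℝ ℝ (Ed d))
        (ContinuousLinearMap.snd ℝ ℝ (Ed d)))

theorem Lh_apply (d : ℕ) (h : ℝ) (ξ w : ℝ × Ed d) :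
    Lh d h ξ w = -(2 * π * h)⁻¹ * epair d w ξ := by
  simp only [Lh, epair, smul_apply, add_apply,
    ContinuousLinearMap.bilinearComp_apply, smul_eq_mul, ContinuousLinearMap.mul_apply',
    ContinuousLinearMap.coe_fst', ContinuousLinearMap.coe_snd', innB_apply]
  rw [real_inner_comm]
  ring

theorem norm_sq_le_epair (d : ℕ) (w : ℝ × Ed d) : ‖w‖ ^ 2 ≤ epair d w w := by
  simp only [epair, real_inner_self_eq_norm_sq]
  rw [Prod.norm_def]
  rcases max_cases ‖w.1‖ ‖w.2‖ with ⟨h, _⟩ | ⟨h, _⟩ <;> rw [h]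
  · rw [Real.norm_eq_abs, sq_abs]; nlinarith [sq_nonneg ‖w.2‖]
  · nlinarith [sq_nonneg w.1]

/-- The semiclassical Fourier transform. -/
def FT (d : ℕ) (h : ℝ) {E : Type} [NormedAddCommGroup E] [NormedSpace ℂ E]
    (a : ℝ × Ed d → E) : ℝ × Ed d → E :=
  VectorFourier.fourierIntegral Real.fourierChar volume (Lh d h).toLinearMap₁₂ a

theorem char_eq (d : ℕ) {h : ℝ} (hh : 0 < h) (ξ w : ℝ × Ed d) :
    ((Real.fourierChar (-(Lh d h ξ w)) : Circle) : ℂ) =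
      Complex.exp (Complex.I * Complex.ofReal (epair d w ξ / h)) := by
  rw [Real.fourierChar_apply, Lh_apply]
  congr 1
  have : (π : ℂ) ≠ 0 := by exact_mod_cast Real.pi_ne_zero
  have h' : (h : ℂ) ≠ 0 := by exact_mod_cast hh.ne'
  push_cast
  field_simp

theorem FT_eq (d : ℕ) {h : ℝ} (hh : 0 < h) {E : Type} [NormedAddCommGroup E] [NormedSpace ℂ E]
    (a : ℝ × Ed d → E) (w : ℝ × Ed d) :
    FT d h a w = ∫ ξ, Complex.exp (Complex.I * Complex.ofReal (epair d w ξ / h)) • a ξ := by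
  simp only [FT, VectorFourier.fourierIntegral]
  congr 1; funext ξ
  rw [← char_eq d hh]; rfl

/-- Families of symbols that are Schwartz in `ξ` uniformly in `z ∈ T`. -/
def US (d : ℕ) (T : Set (ℝ × Ed d)) {E : Type} [NormedAddCommGroup E] [NormedSpace ℝ E]
    (a : ℝ × Ed d → ℝ × Ed d → E) : Prop :=
  (∀ z ∈ T, ContDiff ℝ (⊤ : ℕ∞) (a z)) ∧ ∀ k n : ℕ, ∃ C : ℝ, ∀ z ∈ T, ∀ ξ,
    (1 + ‖ξ‖) ^ k * ‖iteratedFDeriv ℝ n (a z) ξ‖ ≤ C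

theorem int_weight (d : ℕ) : Integrable (fun ξ : ℝ × Ed d => (1 + ‖ξ‖) ^ (-((d : ℝ) + 2))) := by
  have := aux_haar d
  apply integrable_one_add_norm
  simp
  linarith

theorem weight_bound (d : ℕ) (ξ : ℝ × Ed d) {t C : ℝ} (ht : (1 + ‖ξ‖) ^ (d + 2) * t ≤ C) :
    t ≤ C * (1 + ‖ξ‖) ^ (-((d : ℝ) + 2)) := by
  have h1 : 0 < 1 + ‖ξ‖ := by positivity
  rw [Real.rpow_neg h1.le, show ((d : ℝ) + 2) = ((d + 2 : ℕ) : ℝ) by push_cast; ring,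
    Real.rpow_natCast]
  rw [← div_eq_mul_inv, le_div_iff₀ (by positivity)]
  linarith

theorem US.bound {d : ℕ} {T : Set (ℝ × Ed d)} {E : Type} [NormedAddCommGroup E] [NormedSpace ℝ E]
    {a : ℝ × Ed d → ℝ × Ed d → E} (ha : US d T a) (k n : ℕ) :
    ∃ C : ℝ, ∀ z ∈ T, ∀ ξ, ‖ξ‖ ^ k * ‖iteratedFDeriv ℝ n (a z) ξ‖ ≤
      C * (1 + ‖ξ‖) ^ (-((d : ℝ) + 2)) := by
  obtain ⟨C, hC⟩ := ha.2 (d + 2 + k) n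
  refine ⟨C, fun z hz ξ => weight_bound d ξ ?_⟩
  refine le_trans ?_ (hC z hz ξ)
  rw [pow_add _ (d + 2) k, mul_assoc]
  have h1 : ‖ξ‖ ^ k ≤ (1 + ‖ξ‖) ^ k := pow_le_pow_left₀ (norm_nonneg _) (by linarith) k
  gcongr

theorem US.integrable {d : ℕ} {T : Set (ℝ × Ed d)} {E : Type} [NormedAddCommGroup E]
    [NormedSpace ℝ E]
    {a : ℝ × Ed d → ℝ × Ed d → E} (ha : US d T a) (k n : ℕ) {z : ℝ × Ed d} (hz : z ∈ T) :
    Integrable (fun ξ => ‖ξ‖ ^ k * ‖iteratedFDeriv ℝ n (a z) ξ‖) := by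
  obtain ⟨C, hC⟩ := ha.bound k n
  refine ((int_weight d).const_mul C).mono' ?_ (ae_of_all _ fun ξ => ?_)
  · apply Continuous.aestronglyMeasurable
    have := (ha.1 z hz).continuous_iteratedFDeriv (m := n) (by exact_mod_cast le_top)
    fun_prop
  · rw [Real.norm_of_nonneg (by positivity)]
    exact hC z hz ξ

theorem US.integrable0 {d : ℕ} {T : Set (ℝ × Ed d)} {E : Type} [NormedAddCommGroup E]
    [NormedSpace ℝ E]
    {a : ℝ × Ed d → ℝ × Ed d → E} (ha : US d T a) {z : ℝ × Ed d} (hz : z ∈ T) :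
    Integrable (a z) := by
  rw [← integrable_norm_iff (ha.1 z hz).continuous.aestronglyMeasurable]
  simpa using ha.integrable 0 0 hz

theorem US.integrable1 {d : ℕ} {T : Set (ℝ × Ed d)} {E : Type} [NormedAddCommGroup E]
    [NormedSpace ℝ E]
    {a : ℝ × Ed d → ℝ × Ed d → E} (ha : US d T a) {z : ℝ × Ed d} (hz : z ∈ T) :
    Integrable (fun ξ => ‖ξ‖ * ‖a z ξ‖) := by
  simpa using ha.integrable 1 0 hz

theorem US.decay {d : ℕ} {h : ℝ} (hh : 0 < h) {T : Set (ℝ × Ed d)} {E : Type}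
    [NormedAddCommGroup E] [NormedSpace ℂ E]
    {a : ℝ × Ed d → ℝ × Ed d → E} (ha : US d T a) (j n : ℕ) :
    ∃ C : ℝ, ∀ z ∈ T, ∀ w, (1 + ‖w‖) ^ n * ‖iteratedFDeriv ℝ j (FT d h (a z)) w‖ ≤ C := by
  have := aux_haar d
  have key : ∀ m : ℕ, ∃ C : ℝ, ∀ z ∈ T, ∀ w,
      ‖w‖ ^ m * ‖iteratedFDeriv ℝ j (FT d h (a z)) w‖ ≤ C := by
    intro m
    choose C hC using fun p : ℕ × ℕ => ha.bound p.1 p.2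
    let I := ∫ ξ : ℝ × Ed d, (1 + ‖ξ‖) ^ (-((d : ℝ) + 2))
    let M := ∑ p ∈ Finset.range (j + 1) ×ˢ Finset.range (m + 1), C p * I
    let A := (2 * π * ‖Lh d h‖) ^ j * (2 * j + 2) ^ m
    refine ⟨(2 * π * h) ^ m * (A * M), fun z hz w => ?_⟩
    have h1 := VectorFourier.pow_mul_norm_iteratedFDeriv_fourierIntegral_le (Lh d h)
      (μ := volume) (K := ⊤) (N := ⊤) (ha.1 z hz) (fun k n _ _ => ha.integrable k n hz)
      (k := j) (n := m) le_top le_top w w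
    have h2 : ∑ p ∈ Finset.range (j + 1) ×ˢ Finset.range (m + 1),
        ∫ v, ‖v‖ ^ p.1 * ‖iteratedFDeriv ℝ p.2 (a z) v‖ ≤ M := by
      apply Finset.sum_le_sum
      intro p _
      rw [← integral_const_mul]
      exact integral_mono (ha.integrable _ _ hz) ((int_weight d).const_mul _)
        (fun ξ => hC p z hz ξ)
    set N := ‖iteratedFDeriv ℝ j (FT d h (a z)) w‖ with hN
    change |Lh d h w w| ^ m * N ≤ _ at h1
    have h3 : (2 * π * h)⁻¹ * ‖w‖ ^ 2 ≤ |Lh d h w w| := by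
      rw [Lh_apply, abs_mul, abs_neg, abs_of_pos (by positivity)]
      gcongr
      exact (norm_sq_le_epair d w).trans (le_abs_self _)
    have hN0 : 0 ≤ N := norm_nonneg _
    have h4 : ((2 * π * h)⁻¹ * ‖w‖ ^ 2) ^ m * N ≤ ‖w‖ ^ m * (A * M) := by
      calc _ ≤ |Lh d h w w| ^ m * N := by gcongr
        _ ≤ _ := h1
        _ ≤ ‖w‖ ^ m * (2 * π * ‖Lh d h‖) ^ j * (2 * j + 2) ^ m * M := by gcongr
        _ = _ := by simp only [A]; ring
    have h5 : ‖w‖ ^ m * (‖w‖ ^ m * N) ≤ ‖w‖ ^ m * ((2 * π * h) ^ m * (A * M)) := by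
      have : ‖w‖ ^ m * (‖w‖ ^ m * N) =
          (2 * π * h) ^ m * (((2 * π * h)⁻¹ * ‖w‖ ^ 2) ^ m * N) := by
        rw [mul_pow (2 * π * h)⁻¹, inv_pow]
        have : (2 * π * h) ^ m ≠ 0 := by positivity
        generalize (2 * π * h) ^ m = q at this
        field_simp
        ring
      rw [this]
      calc _ ≤ (2 * π * h) ^ m * (‖w‖ ^ m * (A * M)) := by gcongr
        _ = _ := by ring
    rcases eq_or_ne m 0 with rfl | hm
    · simpa using h5
    rcases eq_or_ne w 0 with rfl | hw
    · rw [norm_zero, zero_pow hm, zero_mul]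
      have hM : 0 ≤ M := by
        refine le_trans ?_ h2
        exact Finset.sum_nonneg fun p _ => integral_nonneg fun v => by positivity
      positivity
    · exact le_of_mul_le_mul_left h5 (pow_pos (norm_pos_iff.2 hw) m)
  obtain ⟨C0, h0⟩ := key 0
  obtain ⟨Cn, hn⟩ := key n
  refine ⟨2 ^ (n - 1) * (C0 + Cn), fun z hz w => ?_⟩
  have h1 := add_pow_le (zero_le_one) (norm_nonneg w) n
  rw [one_pow] at h1
  have h2 := h0 z hz w
  have h3 := hn z hz w
  calc _ ≤ (2 ^ (n - 1) * (1 + ‖w‖ ^ n)) * ‖iteratedFDeriv ℝ j (FT d h (a z)) w‖ := by gcongr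
    _ = 2 ^ (n - 1) * (‖w‖ ^ 0 * ‖iteratedFDeriv ℝ j (FT d h (a z)) w‖ +
        ‖w‖ ^ n * ‖iteratedFDeriv ℝ j (FT d h (a z)) w‖) := by ring
    _ ≤ _ := by gcongr

theorem US.mono {d : ℕ} {T T' : Set (ℝ × Ed d)} {E : Type} [NormedAddCommGroup E]
    [NormedSpace ℝ E] {a : ℝ × Ed d → ℝ × Ed d → E} (ha : US d T a) (hT : T' ⊆ T) : US d T' a :=
  ⟨fun z hz => ha.1 z (hT hz), fun k n => (ha.2 k n).imp fun _ hC z hz => hC z (hT hz)⟩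

/-- The open half space. -/
def HS (d : ℕ) : Set (ℝ × Ed d) := {x | 0 < x.1}

theorem HS_open (d : ℕ) : IsOpen (HS d) := isOpen_lt continuous_const continuous_fst

/-- Slabs in the half space. -/
def Slab (d : ℕ) (a b : ℝ) : Set (ℝ × Ed d) := {x | a ≤ x.1 ∧ x.1 ≤ b}

/-- The symbol estimates. -/
def Bd (d : ℕ) (σ : (ℝ × Ed d) → (ℝ × Ed d) → ℂ) : Prop :=
  ∀ (bx bξ : ℕ) (M : ℝ), ∃ C : ℝ, 0 < C ∧
      ∀ x : ℝ × Ed d, 0 < x.1 → ∀ ξ : ℝ × Ed d,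
        ‖iteratedFDeriv ℝ bx
            (fun u : ℝ × Ed d => iteratedFDeriv ℝ bξ (fun v : ℝ × Ed d => σ u v) ξ) x‖ ≤
          C * x.1 ^ ((bx : ℝ) - (bξ : ℝ)) * (1 + x.1 * xiNorm d ξ) ^ (-M)

theorem norm_le_xiNorm (d : ℕ) (ξ : ℝ × Ed d) : ‖ξ‖ ≤ xiNorm d ξ := by
  refine Real.le_sqrt_of_sq_le ?_
  have := norm_sq_le_epair d ξ
  simp only [epair, real_inner_self_eq_norm_sq] at this
  nlinarith

theorem Bd.unif {d : ℕ} {σ : (ℝ × Ed d) → (ℝ × Ed d) → ℂ} (hσ : Bd d σ) {a b : ℝ} (ha : 0 < a)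
    (bx k n : ℕ) : ∃ C : ℝ, ∀ x ∈ Slab d a b, ∀ ξ : ℝ × Ed d,
      (1 + ‖ξ‖) ^ k * ‖iteratedFDeriv ℝ bx
            (fun u : ℝ × Ed d => iteratedFDeriv ℝ n (σ u) ξ) x‖ ≤ C := by
  obtain ⟨C, hC, h⟩ := hσ bx n k
  obtain ⟨B, hB⟩ : ∃ B : ℝ, ∀ y ∈ Set.Icc a b, ‖y ^ ((bx : ℝ) - (n : ℝ))‖ ≤ B := by
    apply isCompact_Icc.exists_bound_of_continuousOn
    intro y hy
    exact (Real.continuousAt_rpow_const y _ (Or.inl (by linarith [hy.1]))).continuousWithinAt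
  have hm : 0 < min 1 a := lt_min one_pos ha
  refine ⟨C * B * ((min 1 a) ^ k)⁻¹, fun x hx ξ => ?_⟩
  have hx0 : 0 < x.1 := lt_of_lt_of_le ha hx.1
  have h1 := h x hx0 ξ
  have hB' := hB x.1 ⟨hx.1, hx.2⟩
  rw [Real.norm_of_nonneg (by positivity)] at hB'
  have hxi : 0 ≤ xiNorm d ξ := Real.sqrt_nonneg _
  have h2 : min 1 a * (1 + ‖ξ‖) ≤ 1 + x.1 * xiNorm d ξ := by
    have e1 : min 1 a * ‖ξ‖ ≤ x.1 * xiNorm d ξ :=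
      mul_le_mul ((min_le_right _ _).trans hx.1) (norm_le_xiNorm d ξ) (norm_nonneg _) hx0.le
    have e2 : min 1 a ≤ 1 := min_le_left _ _
    linarith
  have hpos : 0 < 1 + x.1 * xiNorm d ξ := by positivity
  rw [Real.rpow_neg hpos.le, Real.rpow_natCast] at h1
  have h3 : (1 + ‖ξ‖) ^ k * ((1 + x.1 * xiNorm d ξ) ^ k)⁻¹ ≤ ((min 1 a) ^ k)⁻¹ := by
    have h4 : (min 1 a) ^ k * (1 + ‖ξ‖) ^ k ≤ (1 + x.1 * xiNorm d ξ) ^ k := by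
      rw [← mul_pow]
      exact pow_le_pow_left₀ (by positivity) h2 k
    have h5 : 0 < (min 1 a) ^ k := by positivity
    have h6 : 0 < (1 + x.1 * xiNorm d ξ) ^ k := by positivity
    rw [← div_eq_mul_inv, div_le_iff₀ h6, inv_mul_eq_div, le_div_iff₀ h5]
    linarith
  have hB0 : 0 ≤ B := le_trans (by positivity) hB'
  calc _ ≤ (1 + ‖ξ‖) ^ k * (C * x.1 ^ ((bx : ℝ) - (n : ℝ)) * ((1 + x.1 * xiNorm d ξ) ^ k)⁻¹) := by
        gcongr
    _ = C * x.1 ^ ((bx : ℝ) - (n : ℝ)) * ((1 + ‖ξ‖) ^ k * ((1 + x.1 * xiNorm d ξ) ^ k)⁻¹) := by ring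
    _ ≤ _ := by gcongr

theorem US_sigma {d : ℕ} {σ : (ℝ × Ed d) → (ℝ × Ed d) → ℂ} (hs : Sm (HS d) σ) (hσ : Bd d σ)
    {a b : ℝ} (ha : 0 < a) : US d (Slab d a b) σ := by
  refine ⟨fun z hz => hs.contDiff (HS_open d) (lt_of_lt_of_le ha hz.1), fun k n => ?_⟩
  obtain ⟨C, hC⟩ := hσ.unif (b := b) ha 0 k n
  refine ⟨C, fun z hz ξ => ?_⟩
  have := hC z hz ξ
  rwa [norm_iteratedFDeriv_zero] at this

theorem US_P {d : ℕ} {σ : (ℝ × Ed d) → (ℝ × Ed d) → ℂ} (hs : Sm (HS d) σ) (hσ : Bd d σ)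
    {a b : ℝ} (ha : 0 < a) : US d (Slab d a b) (PD σ) := by
  refine ⟨fun z hz => (hs.P (HS_open d)).contDiff (HS_open d) (lt_of_lt_of_le ha hz.1),
    fun k n => ?_⟩
  obtain ⟨C, hC⟩ := hσ.unif (b := b) ha 1 k n
  refine ⟨C, fun z hz ξ => ?_⟩
  have := hC z hz ξ
  rw [norm_iteratedFDeriv_one] at this
  rwa [Sm.norm_iter (HS_open d) n ℂ σ hs z (lt_of_lt_of_le ha hz.1) ξ]

/-- The oscillatory factor. -/
def osc (d : ℕ) (h : ℝ) (w ξ : ℝ × Ed d) : ℂ := ((Real.fourierChar (-(Lh d h ξ w)) : Circle) : ℂ)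

theorem osc_norm (d : ℕ) (h : ℝ) (w ξ : ℝ × Ed d) : ‖osc d h w ξ‖ = 1 := Circle.norm_coe _

theorem osc_cont (d : ℕ) (h : ℝ) : Continuous (fun p : (ℝ × Ed d) × (ℝ × Ed d) =>
    osc d h p.1 p.2) := by
  have h1 : Continuous fun p : (ℝ × Ed d) × (ℝ × Ed d) => Lh d h p.2 p.1 := by fun_prop
  exact continuous_subtype_val.comp (Real.continuous_fourierChar.comp h1.neg)

/-- Integrand of the Weyl kernel. -/
def Fi (d : ℕ) (h : ℝ) (σ : (ℝ × Ed d) → (ℝ × Ed d) → ℂ) (x x' ξ : ℝ × Ed d) : ℂ :=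
  osc d h (x - x') ξ * σ ((1 / 2 : ℝ) • (x + x')) ξ

/-- Derivative symbol. -/
def Sd (d : ℕ) (h : ℝ) (σ : (ℝ × Ed d) → (ℝ × Ed d) → ℂ) (z ξ : ℝ × Ed d) :
    (ℝ × Ed d) →L[ℝ] ℂ :=
  (1 / 2 : ℝ) • PD σ z ξ + VectorFourier.fourierSMulRight (Lh d h) (σ z) ξ

/-- Derivative of the integrand of the Weyl kernel. -/
def Fi' (d : ℕ) (h : ℝ) (σ : (ℝ × Ed d) → (ℝ × Ed d) → ℂ) (x x' ξ : ℝ × Ed d) :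
    (ℝ × Ed d) →L[ℝ] ℂ :=
  osc d h (x - x') ξ • Sd d h σ ((1 / 2 : ℝ) • (x + x')) ξ

theorem Fi_hasFDerivAt {d : ℕ} {h : ℝ} {σ : (ℝ × Ed d) → (ℝ × Ed d) → ℂ} (hs : Sm (HS d) σ)
    (x x' ξ : ℝ × Ed d) (hx : 0 < x.1) (hx' : 0 < x'.1) :
    HasFDerivAt (fun x => Fi d h σ x x' ξ) (Fi' d h σ x x' ξ) x := by
  have hz : (1 / 2 : ℝ) • (x + x') ∈ HS d := by
    change 0 < (1 / 2 : ℝ) * (x.1 + x'.1)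
    linarith
  have h1 : HasFDerivAt (fun w => osc d h w ξ)
      (osc d h (x - x') ξ • VectorFourier.fourierSMulRight (Lh d h) (fun _ => (1 : ℂ)) ξ)
      (x - x') := by
    have := VectorFourier.hasFDerivAt_fourierChar_smul (Lh d h) (fun _ => (1 : ℂ)) ξ (x - x')
    simpa [osc, Circle.smul_def] using this
  have h2 := h1.comp x ((hasFDerivAt_id x).sub_const x')
  have h3 : HasFDerivAt (fun u => σ u ξ) (PD σ ((1 / 2 : ℝ) • (x + x')) ξ)
      ((1 / 2 : ℝ) • (x + x')) :=
    (hs.hasP (HS_open d) ξ hz).differentiableAt.hasFDerivAt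
  have h4 := h3.comp x (((hasFDerivAt_id x).add_const x').const_smul (1 / 2 : ℝ))
  have h5 := h2.mul h4
  refine h5.congr_fderiv ?_
  refine ContinuousLinearMap.ext fun v => ?_
  simp [Fi', Sd]
  ring

theorem Sd_contOn {d : ℕ} {h : ℝ} {σ : (ℝ × Ed d) → (ℝ × Ed d) → ℂ} (hs : Sm (HS d) σ) :
    ContinuousOn (fun p : (ℝ × Ed d) × (ℝ × Ed d) => Sd d h σ p.1 p.2) {p | p.1 ∈ HS d} := by
  have h1 : ContinuousOn (fun p : (ℝ × Ed d) × (ℝ × Ed d) => PD σ p.1 p.2) {p | p.1 ∈ HS d} :=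
    (hs.P (HS_open d)).continuousOn
  have h2 : ContinuousOn (fun p : (ℝ × Ed d) × (ℝ × Ed d) => σ p.1 p.2) {p | p.1 ∈ HS d} :=
    ContDiffOn.continuousOn hs
  have h3 : Continuous fun p : ((ℝ × Ed d) →L[ℝ] ℝ) × ℂ ↦ p.1.smulRight p.2 :=
    (ContinuousLinearMap.smulRightL ℝ (ℝ × Ed d) ℂ).continuous₂
  have h4 : ContinuousOn (fun p : (ℝ × Ed d) × (ℝ × Ed d) =>
      (Lh d h p.2).smulRight (σ p.1 p.2)) {p | p.1 ∈ HS d} := by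
    apply h3.comp_continuousOn (f := fun p : (ℝ × Ed d) × (ℝ × Ed d) => (Lh d h p.2, σ p.1 p.2))
    apply ContinuousOn.prodMk _ h2
    exact ((Lh d h).continuous.comp continuous_snd).continuousOn
  exact (h1.const_smul (1 / 2 : ℝ)).add (h4.const_smul (-(2 * π * Complex.I)))

theorem Sd_bound {d : ℕ} {h : ℝ} {σ : (ℝ × Ed d) → (ℝ × Ed d) → ℂ} (hs : Sm (HS d) σ)
    (hσ : Bd d σ) {a b : ℝ} (ha : 0 < a) : ∃ C : ℝ, ∀ z ∈ Slab d a b, ∀ ξ,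
    ‖Sd d h σ z ξ‖ ≤ C * (1 + ‖ξ‖) ^ (-((d : ℝ) + 2)) := by
  obtain ⟨C1, h1⟩ := (US_P hs hσ (b := b) ha).bound 0 0
  obtain ⟨C2, h2⟩ := (US_sigma hs hσ (b := b) ha).bound 1 0
  refine ⟨1 / 2 * C1 + 2 * π * ‖Lh d h‖ * C2, fun z hz ξ => ?_⟩
  have e1 := h1 z hz ξ
  have e2 := h2 z hz ξ
  have e3 := VectorFourier.norm_fourierSMulRight_le (Lh d h) (σ z) ξ
  simp only [norm_iteratedFDeriv_zero, pow_zero, pow_one, one_mul] at e1 e2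
  calc _ ≤ ‖(1 / 2 : ℝ) • PD σ z ξ‖ + ‖VectorFourier.fourierSMulRight (Lh d h) (σ z) ξ‖ :=
        norm_add_le _ _
    _ ≤ 1 / 2 * ‖PD σ z ξ‖ + 2 * π * ‖Lh d h‖ * (‖ξ‖ * ‖σ z ξ‖) := by
        rw [norm_smul, Real.norm_of_nonneg (by norm_num : (0:ℝ) ≤ 1 / 2)]
        linarith
    _ ≤ 1 / 2 * (C1 * (1 + ‖ξ‖) ^ (-((d : ℝ) + 2))) +
        2 * π * ‖Lh d h‖ * (C2 * (1 + ‖ξ‖) ^ (-((d : ℝ) + 2))) := by gcongr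
    _ = _ := by ring

theorem wk_eq (d : ℕ) {h : ℝ} (hh : 0 < h) (σ : (ℝ × Ed d) → (ℝ × Ed d) → ℂ) (x x' : ℝ × Ed d) :
    weylKernel d h σ x x' = ((2 * π * h) ^ (d + 1))⁻¹ • ∫ ξ, Fi d h σ x x' ξ := by
  simp only [weylKernel, Fi, osc, char_eq d hh]

/-- The derivative of the Weyl kernel. -/
def Kd (d : ℕ) (h : ℝ) (σ : (ℝ × Ed d) → (ℝ × Ed d) → ℂ) (x x' : ℝ × Ed d) :
    (ℝ × Ed d) →L[ℝ] ℂ :=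
  ((2 * π * h) ^ (d + 1))⁻¹ • ∫ ξ, Fi' d h σ x x' ξ

theorem mid_slab {d : ℕ} {a b a' b' : ℝ} {x x' : ℝ × Ed d} (hx : x ∈ Slab d a b)
    (hx' : x' ∈ Slab d a' b') : (1 / 2 : ℝ) • (x + x') ∈ Slab d ((a + a') / 2) ((b + b') / 2) := by
  obtain ⟨h1, h2⟩ := hx
  obtain ⟨h3, h4⟩ := hx'
  constructor
  · change _ ≤ (1 / 2 : ℝ) * (x.1 + x'.1); linarith
  · change (1 / 2 : ℝ) * (x.1 + x'.1) ≤ _; linarith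

theorem self_slab {d : ℕ} (x : ℝ × Ed d) : x ∈ Slab d x.1 x.1 := ⟨le_rfl, le_rfl⟩

theorem ball_slab {d : ℕ} {x u : ℝ × Ed d} (hu : u ∈ Metric.ball x (x.1 / 2)) :
    u ∈ Slab d (x.1 / 2) (3 * x.1 / 2) := by
  have h1 : |u.1 - x.1| < x.1 / 2 := by
    have h2 : ‖(u - x).1‖ ≤ ‖u - x‖ := norm_fst_le _
    rw [Metric.mem_ball, dist_eq_norm] at hu
    exact lt_of_le_of_lt h2 hu
  rw [abs_lt] at h1
  constructor <;> linarith [h1.1, h1.2]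

theorem mid_HS {d : ℕ} {x x' : ℝ × Ed d} (hx : 0 < x.1) (hx' : 0 < x'.1) :
    (1 / 2 : ℝ) • (x + x') ∈ HS d := by
  change 0 < (1 / 2 : ℝ) * (x.1 + x'.1)
  linarith

theorem Fi_cont {d : ℕ} {h : ℝ} {σ : (ℝ × Ed d) → (ℝ × Ed d) → ℂ} (hs : Sm (HS d) σ)
    {x : ℝ × Ed d} (hx : 0 < x.1) :
    ContinuousOn (fun p : (ℝ × Ed d) × (ℝ × Ed d) => Fi d h σ x p.1 p.2) {p | p.1 ∈ HS d} := by
  have h2 : ContinuousOn (fun p : (ℝ × Ed d) × (ℝ × Ed d) => σ p.1 p.2) {p | p.1 ∈ HS d} :=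
    ContDiffOn.continuousOn hs
  have h3 : ContinuousOn (fun p : (ℝ × Ed d) × (ℝ × Ed d) =>
      σ ((1 / 2 : ℝ) • (x + p.1)) p.2) {p | p.1 ∈ HS d} :=
    h2.comp (f := fun p : (ℝ × Ed d) × (ℝ × Ed d) => ((1 / 2 : ℝ) • (x + p.1), p.2))
      (by fun_prop) (fun p hp => mid_HS hx hp)
  have h4 : Continuous (fun p : (ℝ × Ed d) × (ℝ × Ed d) => osc d h (x - p.1) p.2) :=
    (osc_cont d h).comp (f := fun p : (ℝ × Ed d) × (ℝ × Ed d) => (x - p.1, p.2)) (by fun_prop)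
  exact h4.continuousOn.mul h3

theorem Fi'_cont {d : ℕ} {h : ℝ} {σ : (ℝ × Ed d) → (ℝ × Ed d) → ℂ} (hs : Sm (HS d) σ)
    {x : ℝ × Ed d} (hx : 0 < x.1) :
    ContinuousOn (fun p : (ℝ × Ed d) × (ℝ × Ed d) => Fi' d h σ x p.1 p.2) {p | p.1 ∈ HS d} := by
  have h3 : ContinuousOn (fun p : (ℝ × Ed d) × (ℝ × Ed d) =>
      Sd d h σ ((1 / 2 : ℝ) • (x + p.1)) p.2) {p | p.1 ∈ HS d} :=
    (Sd_contOn hs).comp (f := fun p : (ℝ × Ed d) × (ℝ × Ed d) => ((1 / 2 : ℝ) • (x + p.1), p.2))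
      (by fun_prop) (fun p hp => mid_HS hx hp)
  have h4 : Continuous (fun p : (ℝ × Ed d) × (ℝ × Ed d) => osc d h (x - p.1) p.2) :=
    (osc_cont d h).comp (f := fun p : (ℝ × Ed d) × (ℝ × Ed d) => (x - p.1, p.2)) (by fun_prop)
  exact h4.continuousOn.smul h3

theorem slice_cont {d : ℕ} {E : Type} [TopologicalSpace E]
    {g : (ℝ × Ed d) × (ℝ × Ed d) → E} (hg : ContinuousOn g {p | p.1 ∈ HS d})
    {x' : ℝ × Ed d} (hx' : 0 < x'.1) : Continuous fun ξ => g (x', ξ) := by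
  rw [← continuousOn_univ]
  exact hg.comp (f := fun ξ => (x', ξ)) (by fun_prop) (fun ξ _ => hx')

theorem wk_hasFDerivAt {d : ℕ} {h : ℝ} (hh : 0 < h) {σ : (ℝ × Ed d) → (ℝ × Ed d) → ℂ}
    (hs : Sm (HS d) σ) (hσ : Bd d σ) {x x' : ℝ × Ed d} (hx : 0 < x.1) (hx' : 0 < x'.1) :
    HasFDerivAt (fun u => weylKernel d h σ u x') (Kd d h σ x x') x := by
  have hfun : (fun u => weylKernel d h σ u x') =
      fun u => ((2 * π * h) ^ (d + 1))⁻¹ • ∫ ξ, Fi d h σ u x' ξ := by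
    funext u; exact wk_eq d hh σ u x'
  rw [hfun]
  suffices hmain : HasFDerivAt (fun u => ∫ ξ, Fi d h σ u x' ξ) (∫ ξ, Fi' d h σ x x' ξ) x from
    hmain.const_smul (((2 * π * h) ^ (d + 1))⁻¹ : ℝ)
  have hb : ∀ u ∈ Metric.ball x (x.1 / 2), 0 < u.1 := fun u hu => by
    have := (ball_slab hu).1
    linarith
  have hxx : x ∈ Metric.ball x (x.1 / 2) := Metric.mem_ball_self (by linarith)
  have hpos : 0 < (x.1 / 2 + x'.1) / 2 := by linarith
  obtain ⟨C, hC⟩ := Sd_bound (h := h) hs hσ (b := (3 * x.1 / 2 + x'.1) / 2) hpos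
  refine hasFDerivAt_integral_of_dominated_of_fderiv_le (𝕜 := ℝ) (F := fun u ξ => Fi d h σ u x' ξ)
    (F' := fun u ξ => Fi' d h σ u x' ξ) (s := Metric.ball x (x.1 / 2))
    (bound := fun ξ : ℝ × Ed d => C * (1 + ‖ξ‖) ^ (-((d : ℝ) + 2)))
    (Metric.ball_mem_nhds x (by linarith)) ?_ ?_ ?_ ?_ ?_ ?_
  · filter_upwards [Metric.ball_mem_nhds x (by linarith : 0 < x.1 / 2)] with u hu
    exact (slice_cont (Fi_cont hs (hb u hu)) hx').aestronglyMeasurable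
  · have h1 := (US_sigma hs hσ (b := (3 * x.1 / 2 + x'.1) / 2) hpos).integrable0
      (mid_slab (ball_slab hxx) (self_slab x'))
    refine h1.norm.mono' (slice_cont (Fi_cont hs hx) hx').aestronglyMeasurable
      (ae_of_all _ fun (ξ : ℝ × Ed d) => ?_)
    rw [Fi, norm_mul, osc_norm, one_mul]
  · exact (slice_cont (Fi'_cont hs hx) hx').aestronglyMeasurable
  · refine ae_of_all _ fun ξ u hu => ?_
    rw [Fi', norm_smul, osc_norm, one_mul]
    exact hC _ (mid_slab (ball_slab hu) (self_slab x')) ξ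
  · exact (int_weight d).const_mul C
  · exact ae_of_all _ fun ξ u hu => Fi_hasFDerivAt hs u x' ξ (hb u hu) hx'

theorem int_Fi (d : ℕ) (h : ℝ) (σ : (ℝ × Ed d) → (ℝ × Ed d) → ℂ) (x x' : ℝ × Ed d) :
    ∫ ξ, Fi d h σ x x' ξ = FT d h (σ ((1 / 2 : ℝ) • (x + x'))) (x - x') := rfl

theorem int_Fi' {d : ℕ} {h : ℝ} {σ : (ℝ × Ed d) → (ℝ × Ed d) → ℂ}
    (hs : Sm (HS d) σ) (hσ : Bd d σ) {x x' : ℝ × Ed d} (hx : 0 < x.1) (hx' : 0 < x'.1) :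
    ∫ ξ, Fi' d h σ x x' ξ = (1 / 2 : ℝ) • FT d h (PD σ ((1 / 2 : ℝ) • (x + x'))) (x - x') +
      fderiv ℝ (FT d h (σ ((1 / 2 : ℝ) • (x + x')))) (x - x') := by
  have hz := mid_slab (self_slab x) (self_slab x')
  have hpos : 0 < (x.1 + x'.1) / 2 := by linarith
  have i1 := (US_P hs hσ (b := (x.1 + x'.1) / 2) hpos).integrable0 hz
  have i2 := (US_sigma hs hσ (b := (x.1 + x'.1) / 2) hpos).integrable0 hz
  have i3 := (US_sigma hs hσ (b := (x.1 + x'.1) / 2) hpos).integrable1 hz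
  set z := (1 / 2 : ℝ) • (x + x')
  have e1 := VectorFourier.fderiv_fourierIntegral (Lh d h) i2 i3
  have e1' : fderiv ℝ (FT d h (σ z)) (x - x') =
      FT d h (VectorFourier.fourierSMulRight (Lh d h) (σ z)) (x - x') := congrFun e1 (x - x')
  rw [e1']
  have i4 : Integrable (VectorFourier.fourierSMulRight (Lh d h) (σ z)) := by
    refine (i3.const_mul (2 * π * ‖Lh d h‖)).mono' ?_ (ae_of_all _ fun ξ => ?_)
    · exact i2.aestronglyMeasurable.fourierSMulRight
    · refine (VectorFourier.norm_fourierSMulRight_le (Lh d h) (σ z) ξ).trans (le_of_eq (by ring))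
  have hc : Continuous fun ξ => osc d h (x - x') ξ :=
    (osc_cont d h).comp (f := fun ξ => (x - x', ξ)) (by fun_prop)
  have i5 : Integrable fun ξ => osc d h (x - x') ξ • PD σ z ξ := by
    refine i1.norm.mono' (hc.aestronglyMeasurable.smul i1.aestronglyMeasurable)
      (ae_of_all _ fun ξ => ?_)
    rw [norm_smul, osc_norm, one_mul]
  have i6 : Integrable fun ξ =>
      osc d h (x - x') ξ • VectorFourier.fourierSMulRight (Lh d h) (σ z) ξ := by
    refine i4.norm.mono' (hc.aestronglyMeasurable.smul i4.aestronglyMeasurable)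
      (ae_of_all _ fun ξ => ?_)
    rw [norm_smul, osc_norm, one_mul]
  have e2 : (fun ξ => Fi' d h σ x x' ξ) = fun ξ => (1 / 2 : ℝ) • (osc d h (x - x') ξ • PD σ z ξ) +
      osc d h (x - x') ξ • VectorFourier.fourierSMulRight (Lh d h) (σ z) ξ := by
    funext ξ
    rw [Fi', Sd, smul_add, smul_comm]
  have i7 : Integrable fun ξ => (1 / 2 : ℝ) • (osc d h (x - x') ξ • PD σ z ξ) :=
    i5.smul (1 / 2 : ℝ)
  rw [e2, integral_add i7 i6, integral_smul]
  rfl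

theorem kernel_bound {d : ℕ} {h : ℝ} (hh : 0 < h) {σ : (ℝ × Ed d) → (ℝ × Ed d) → ℂ}
    (hs : Sm (HS d) σ) (hσ : Bd d σ) {a b a' b' : ℝ} (ha : 0 < a) (ha' : 0 < a') :
    ∃ C : ℝ, 0 ≤ C ∧ ∀ x ∈ Slab d a b, ∀ x' ∈ Slab d a' b',
      ‖weylKernel d h σ x x'‖ ≤ C * (1 + ‖x - x'‖) ^ (-((d : ℝ) + 2)) ∧
      ‖Kd d h σ x x'‖ ≤ C * (1 + ‖x - x'‖) ^ (-((d : ℝ) + 2)) := by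
  have hpos : 0 < (a + a') / 2 := by linarith
  have u1 := US_sigma hs hσ (b := (b + b') / 2) hpos
  have u2 := US_P hs hσ (b := (b + b') / 2) hpos
  obtain ⟨C0, h0⟩ := u1.decay hh 0 (d + 2)
  obtain ⟨C1, h1⟩ := u1.decay hh 1 (d + 2)
  obtain ⟨C2, h2⟩ := u2.decay hh 0 (d + 2)
  set c := ((2 * π * h) ^ (d + 1))⁻¹ with hc
  have hc0 : 0 ≤ c := by positivity
  refine ⟨c * (|C0| + |C1| + |C2|), by positivity, fun x hx x' hx' => ?_⟩
  have hz := mid_slab hx hx'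
  have e0 := weight_bound d _ (h0 _ hz (x - x'))
  have e1 := weight_bound d _ (h1 _ hz (x - x'))
  have e2 := weight_bound d _ (h2 _ hz (x - x'))
  rw [norm_iteratedFDeriv_zero] at e0 e2
  rw [norm_iteratedFDeriv_one] at e1
  set W := (1 + ‖x - x'‖) ^ (-((d : ℝ) + 2))
  have hW : 0 ≤ W := by positivity
  have f0 := mul_le_mul_of_nonneg_right (le_abs_self C0) hW
  have f1 := mul_le_mul_of_nonneg_right (le_abs_self C1) hW
  have f2 := mul_le_mul_of_nonneg_right (le_abs_self C2) hW
  have g0 : 0 ≤ |C0| * W := by positivity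
  have g1 : 0 ≤ |C1| * W := by positivity
  have g2 : 0 ≤ |C2| * W := by positivity
  constructor
  · rw [wk_eq d hh, norm_smul, Real.norm_of_nonneg hc0, int_Fi, mul_assoc]
    refine mul_le_mul_of_nonneg_left ?_ hc0
    linarith
  · rw [Kd, norm_smul, Real.norm_of_nonneg hc0,
      int_Fi' hs hσ (lt_of_lt_of_le ha hx.1) (lt_of_lt_of_le ha' hx'.1), mul_assoc]
    refine mul_le_mul_of_nonneg_left ?_ hc0
    refine (norm_add_le _ _).trans ?_
    rw [norm_smul, Real.norm_of_nonneg (by norm_num : (0:ℝ) ≤ 1 / 2)]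
    linarith

/-- The unit vector in direction `θ_i`. -/
def ev (d : ℕ) (i : Fin d) : ℝ × Ed d := ((0 : ℝ), (EuclideanSpace.single i (1 : ℝ) : Ed d))

/-- The unit vector in direction `Y`. -/
def yv (d : ℕ) : ℝ × Ed d := ((1 : ℝ), (0 : Ed d))

/-- The composed symbol. -/
def sth (d : ℕ) (h : ℝ) (i : Fin d) (σ : (ℝ × Ed d) → (ℝ × Ed d) → ℂ) (z ξ : ℝ × Ed d) : ℂ :=
          Complex.I * ((z.1 * ξ.2 i : ℝ) : ℂ) * σ z ξ
            - ((h / 2 : ℝ) : ℂ) * ((ξ.2 i : ℝ) : ℂ) *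
                fderiv ℝ (σ z) ξ ((1 : ℝ), (0 : Ed d))
            + ((h / 2 : ℝ) : ℂ) * ((z.1 : ℝ) : ℂ) *
                fderiv ℝ (fun w : ℝ × Ed d => σ w ξ) z
                  ((0 : ℝ), (EuclideanSpace.single i (1 : ℝ) : Ed d))
            + Complex.I * ((h ^ 2 / 4 : ℝ) : ℂ) *
                fderiv ℝ (fun w : ℝ × Ed d => fderiv ℝ (σ w) ξ ((1 : ℝ), (0 : Ed d))) z
                  ((0 : ℝ), (EuclideanSpace.single i (1 : ℝ) : Ed d))

/-- Auxiliary symbol. -/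
def bb (d : ℕ) (h : ℝ) (i : Fin d) (σ : (ℝ × Ed d) → (ℝ × Ed d) → ℂ) (z ξ : ℝ × Ed d) : ℂ :=
  Complex.I * ((ξ.2 i : ℝ) : ℂ) * σ z ξ + ((h / 2 : ℝ) : ℂ) * PD σ z ξ (ev d i)

/-- The `Y` derivative of the auxiliary symbol. -/
def bY (d : ℕ) (h : ℝ) (i : Fin d) (σ : (ℝ × Ed d) → (ℝ × Ed d) → ℂ) (z ξ : ℝ × Ed d) : ℂ :=
  Complex.I * ((ξ.2 i : ℝ) : ℂ) * QD σ z ξ (yv d) +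
    ((h / 2 : ℝ) : ℂ) * QD (PD σ) z ξ (yv d) (ev d i)

theorem bb_eq {d : ℕ} {h : ℝ} (hh : 0 < h) (i : Fin d) (σ : (ℝ × Ed d) → (ℝ × Ed d) → ℂ)
    (z ξ : ℝ × Ed d) : (h : ℂ) * Sd d h σ z ξ (ev d i) = bb d h i σ z ξ := by
  have h' : (h : ℂ) ≠ 0 := by exact_mod_cast hh.ne'
  have hp : (π : ℂ) ≠ 0 := by exact_mod_cast Real.pi_ne_zero
  have e : Lh d h ξ (ev d i) = -(2 * π * h)⁻¹ * ξ.2 i := by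
    rw [Lh_apply]
    simp [epair, ev, EuclideanSpace.inner_single_left]
  simp only [Sd, bb, add_apply, smul_apply, VectorFourier.fourierSMulRight_apply, e]
  simp only [Complex.real_smul, smul_eq_mul]
  push_cast
  field_simp
  ring

theorem sth_eq {d : ℕ} {h : ℝ} (i : Fin d) {σ : (ℝ × Ed d) → (ℝ × Ed d) → ℂ}
    (hs : Sm (HS d) σ) {z : ℝ × Ed d} (hz : z ∈ HS d) (ξ : ℝ × Ed d) :
    sth d h i σ z ξ = (z.1 : ℂ) * bb d h i σ z ξ +
      (Complex.I * ((h / 2 : ℝ) : ℂ)) * bY d h i σ z ξ := by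
  have e1 : fderiv ℝ (fun w : ℝ × Ed d => fderiv ℝ (σ w) ξ (yv d)) z (ev d i) =
      QD (PD σ) z ξ (yv d) (ev d i) := by
    rw [hs.comm (HS_open d) ξ hz, ContinuousLinearMap.flip_apply]
    have h1 : DifferentiableAt ℝ (fun w => QD σ w ξ) z :=
      ((hs.Q (HS_open d)).hasP (HS_open d) ξ hz).differentiableAt
    change fderiv ℝ (fun w : ℝ × Ed d => QD σ w ξ (yv d)) z (ev d i) = _
    rw [fderiv_clm_apply h1 (differentiableAt_const _)]
    simp [PD]
  have e2 : sth d h i σ z ξ = Complex.I * ((z.1 * ξ.2 i : ℝ) : ℂ) * σ z ξ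
            - ((h / 2 : ℝ) : ℂ) * ((ξ.2 i : ℝ) : ℂ) * QD σ z ξ (yv d)
            + ((h / 2 : ℝ) : ℂ) * ((z.1 : ℝ) : ℂ) * PD σ z ξ (ev d i)
            + Complex.I * ((h ^ 2 / 4 : ℝ) : ℂ) *
              fderiv ℝ (fun w : ℝ × Ed d => fderiv ℝ (σ w) ξ (yv d)) z (ev d i) := rfl
  rw [e2, e1, bb, bY]
  push_cast
  linear_combination (-(h / 2 : ℂ) * ((ξ.2 i : ℝ) : ℂ) * QD σ z ξ (yv d)) *
    (Complex.I_sq)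

theorem bb_hasFDerivAt {d : ℕ} {h : ℝ} (i : Fin d) {σ : (ℝ × Ed d) → (ℝ × Ed d) → ℂ}
    (hs : Sm (HS d) σ) {z : ℝ × Ed d} (hz : z ∈ HS d) (ξ : ℝ × Ed d) :
    ∃ B : (ℝ × Ed d) →L[ℝ] ℂ, HasFDerivAt (bb d h i σ z) B ξ ∧ B (yv d) = bY d h i σ z ξ := by
  have h1 : HasFDerivAt (σ z) (QD σ z ξ) ξ :=
    (hs.hasQ (HS_open d) ξ hz).differentiableAt.hasFDerivAt
  have h2 : HasFDerivAt (PD σ z) (QD (PD σ) z ξ) ξ :=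
    ((hs.P (HS_open d)).hasQ (HS_open d) ξ hz).differentiableAt.hasFDerivAt
  have h3 : HasFDerivAt (fun ξ : ℝ × Ed d => ((ξ.2 i : ℝ) : ℂ))
      (Complex.ofRealCLM.comp ((EuclideanSpace.proj i : Ed d →L[ℝ] ℝ).comp
        (ContinuousLinearMap.snd ℝ ℝ (Ed d)))) ξ :=
    (Complex.ofRealCLM.comp ((EuclideanSpace.proj i : Ed d →L[ℝ] ℝ).comp
        (ContinuousLinearMap.snd ℝ ℝ (Ed d)))).hasFDerivAt
  have h4 := ((h3.const_mul Complex.I).mul h1).add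
    ((h2.clm_apply (hasFDerivAt_const (ev d i) ξ)).const_mul ((h / 2 : ℝ) : ℂ))
  refine ⟨_, h4, ?_⟩
  simp [bY, yv]

theorem osc_hasFDerivAt {d : ℕ} {h : ℝ} (hh : 0 < h) (w ξ : ℝ × Ed d) :
    ∃ B : (ℝ × Ed d) →L[ℝ] ℂ, HasFDerivAt (fun ξ => osc d h w ξ) B ξ ∧
      B (yv d) = (Complex.I * (w.1 : ℂ) * (h : ℂ)⁻¹) * osc d h w ξ := by
  have hp : (π : ℂ) ≠ 0 := by exact_mod_cast Real.pi_ne_zero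
  have h' : (h : ℂ) ≠ 0 := by exact_mod_cast hh.ne'
  have e : (fun ξ => osc d h w ξ) = fun ξ =>
      Complex.exp ((-(2 * π * Complex.I)) * ((((Lh d h).flip w) ξ : ℝ) : ℂ)) := by
    funext ξ
    rw [osc, Real.fourierChar_apply, ContinuousLinearMap.flip_apply]
    congr 1
    push_cast
    ring
  have h3 : HasFDerivAt (fun ξ : ℝ × Ed d => ((((Lh d h).flip w) ξ : ℝ) : ℂ))
      (Complex.ofRealCLM.comp ((Lh d h).flip w)) ξ :=
    (Complex.ofRealCLM.comp ((Lh d h).flip w)).hasFDerivAt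
  have h4 := (h3.const_mul (-(2 * π * Complex.I))).cexp
  rw [← e] at h4
  refine ⟨_, h4, ?_⟩
  have e2 : Lh d h (yv d) w = -(2 * π * h)⁻¹ * w.1 := by
    rw [Lh_apply]; simp [epair, yv]
  have e3 := congrFun e ξ
  simp only [smul_apply, ContinuousLinearMap.comp_apply, ContinuousLinearMap.flip_apply,
    Complex.ofRealCLM_apply, e2, smul_eq_mul]
  rw [e3]
  simp only [ContinuousLinearMap.flip_apply]
  push_cast
  field_simp

theorem osc_integrable {d : ℕ} (h : ℝ) (w : ℝ × Ed d) {E : Type} [NormedAddCommGroup E]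
    [NormedSpace ℂ E] {g : ℝ × Ed d → E} (hg : Integrable g) :
    Integrable fun ξ => osc d h w ξ • g ξ := by
  have hc : Continuous fun ξ => osc d h w ξ :=
    (osc_cont d h).comp (f := fun ξ => (w, ξ)) (by fun_prop)
  refine hg.norm.mono' (hc.aestronglyMeasurable.smul hg.aestronglyMeasurable)
    (ae_of_all _ fun ξ => ?_)
  rw [norm_smul, osc_norm, one_mul]

theorem Sd_integrable {d : ℕ} {h : ℝ} {σ : (ℝ × Ed d) → (ℝ × Ed d) → ℂ}
    (hs : Sm (HS d) σ) (hσ : Bd d σ) {z : ℝ × Ed d} (hz : z ∈ HS d) :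
    Integrable (Sd d h σ z) := by
  obtain ⟨C, hC⟩ := Sd_bound (h := h) hs hσ (b := z.1) hz
  refine ((int_weight d).const_mul C).mono' (slice_cont (Sd_contOn hs) hz).aestronglyMeasurable
    (ae_of_all _ fun ξ => hC z (self_slab z) ξ)

theorem bb_integrable {d : ℕ} {h : ℝ} (hh : 0 < h) (i : Fin d) {σ : (ℝ × Ed d) → (ℝ × Ed d) → ℂ}
    (hs : Sm (HS d) σ) (hσ : Bd d σ) {z : ℝ × Ed d} (hz : z ∈ HS d) :
    Integrable (bb d h i σ z) := by
  have h1 := ((Sd_integrable (h := h) hs hσ hz).apply_continuousLinearMap (ev d i)).const_mul (h : ℂ)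
  simp only [bb_eq hh i σ z] at h1
  exact h1

theorem bY_integrable {d : ℕ} {h : ℝ} (i : Fin d) {σ : (ℝ × Ed d) → (ℝ × Ed d) → ℂ}
    (hs : Sm (HS d) σ) (hσ : Bd d σ) {z : ℝ × Ed d} (hz : z ∈ HS d) :
    Integrable (bY d h i σ z) := by
  have i1 := (US_sigma hs hσ (b := z.1) hz).integrable 1 1 (self_slab z)
  have i2 := (US_P hs hσ (b := z.1) hz).integrable 0 1 (self_slab z)
  simp only [norm_iteratedFDeriv_one, pow_one, pow_zero, one_mul] at i1 i2
  have c1 : Continuous (QD σ z) := ((hs.Q (HS_open d)).contDiff (HS_open d) hz).continuous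
  have c2 : Continuous (QD (PD σ) z) :=
    (((hs.P (HS_open d)).Q (HS_open d)).contDiff (HS_open d) hz).continuous
  refine Integrable.add ?_ ?_
  · refine (i1.mul_const ‖yv d‖).mono' ?_ (ae_of_all _ fun ξ => ?_)
    · apply Continuous.aestronglyMeasurable
      fun_prop
    · rw [norm_mul, norm_mul, Complex.norm_I, one_mul, Complex.norm_real, mul_assoc]
      refine mul_le_mul ?_ (ContinuousLinearMap.le_opNorm _ _) (norm_nonneg _) (norm_nonneg _)
      exact (PiLp.norm_apply_le ξ.2 i).trans (norm_snd_le ξ)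
  · refine Integrable.const_mul ?_ _
    refine ((i2.mul_const ‖yv d‖).mul_const ‖ev d i‖).mono' ?_ (ae_of_all _ fun ξ => ?_)
    · apply Continuous.aestronglyMeasurable
      fun_prop
    · refine (ContinuousLinearMap.le_opNorm _ _).trans ?_
      refine mul_le_mul_of_nonneg_right ?_ (norm_nonneg _)
      exact ContinuousLinearMap.le_opNorm _ _

theorem ibp {d : ℕ} {h : ℝ} (hh : 0 < h) (i : Fin d) {σ : (ℝ × Ed d) → (ℝ × Ed d) → ℂ}
    (hs : Sm (HS d) σ) (hσ : Bd d σ) {z : ℝ × Ed d} (hz : z ∈ HS d) (w : ℝ × Ed d) :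
    ∫ ξ, osc d h w ξ * bY d h i σ z ξ =
      -((Complex.I * (w.1 : ℂ) * (h : ℂ)⁻¹) * ∫ ξ, osc d h w ξ * bb d h i σ z ξ) := by
  have := aux_haar d
  have e1 : ∀ ξ, fderiv ℝ (bb d h i σ z) ξ (yv d) = bY d h i σ z ξ := fun ξ => by
    obtain ⟨B, hB, hB'⟩ := bb_hasFDerivAt (h := h) i hs hz ξ
    rw [hB.fderiv, hB']
  have e2 : ∀ ξ, fderiv ℝ (fun ξ => osc d h w ξ) ξ (yv d) =
      (Complex.I * (w.1 : ℂ) * (h : ℂ)⁻¹) * osc d h w ξ := fun ξ => by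
    obtain ⟨B, hB, hB'⟩ := osc_hasFDerivAt hh w ξ
    rw [hB.fderiv, hB']
  have i1 : Integrable fun ξ => osc d h w ξ * bb d h i σ z ξ :=
    osc_integrable h w (bb_integrable hh i hs hσ hz)
  have i2 : Integrable fun ξ => osc d h w ξ * bY d h i σ z ξ :=
    osc_integrable h w (bY_integrable i hs hσ hz)
  have key := integral_mul_fderiv_eq_neg_fderiv_mul_of_integrable (μ := volume)
    (f := fun ξ => osc d h w ξ) (g := bb d h i σ z) (v := yv d)
    (by simp only [e2, mul_assoc]
        simp only [← mul_assoc]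
        simpa only [mul_assoc] using i1.const_mul (Complex.I * (w.1 : ℂ) * (h : ℂ)⁻¹))
    (by simpa only [e1] using i2) i1
    (fun ξ _ => (osc_hasFDerivAt hh w ξ).choose_spec.1.differentiableAt)
    (fun ξ _ => (bb_hasFDerivAt (h := h) i hs hz ξ).choose_spec.1.differentiableAt)
  simp only [e1, e2] at key
  rw [key, ← integral_const_mul]
  simp only [mul_assoc]

theorem ker_id {d : ℕ} {h : ℝ} (hh : 0 < h) (i : Fin d) {σ : (ℝ × Ed d) → (ℝ × Ed d) → ℂ}
    (hs : Sm (HS d) σ) (hσ : Bd d σ) {x x' : ℝ × Ed d} (hx : 0 < x.1) (hx' : 0 < x'.1) :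
    ((h * x.1 : ℝ) : ℂ) * Kd d h σ x x' (ev d i) = weylKernel d h (sth d h i σ) x x' := by
  have hz := mid_HS hx hx'
  have h' : (h : ℂ) ≠ 0 := by exact_mod_cast hh.ne'
  have hz1 : (((1 / 2 : ℝ) • (x + x')).1 : ℂ) = (x.1 + x'.1) / 2 := by
    simp only [Prod.smul_fst, Prod.fst_add, smul_eq_mul]; push_cast; ring
  have hw1 : ((x - x').1 : ℂ) = x.1 - x'.1 := by
    simp only [Prod.fst_sub]; push_cast; ring
  rw [wk_eq d hh, Kd, smul_apply]
  have e0 : (∫ ξ, Fi' d h σ x x' ξ) (ev d i) = ∫ ξ, Fi' d h σ x x' ξ (ev d i) :=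
    ContinuousLinearMap.integral_apply (osc_integrable h (x - x') (Sd_integrable hs hσ hz)) _
  have hI := ibp hh i hs hσ hz (x - x')
  have i1 : Integrable fun ξ => osc d h (x - x') ξ * bb d h i σ ((1 / 2 : ℝ) • (x + x')) ξ :=
    osc_integrable h (x - x') (bb_integrable hh i hs hσ hz)
  have i2 : Integrable fun ξ => osc d h (x - x') ξ * bY d h i σ ((1 / 2 : ℝ) • (x + x')) ξ :=
    osc_integrable h (x - x') (bY_integrable i hs hσ hz)
  have e1 : (fun ξ => Fi d h (sth d h i σ) x x' ξ) = fun ξ =>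
      (((1 / 2 : ℝ) • (x + x')).1 : ℂ) *
        (osc d h (x - x') ξ * bb d h i σ ((1 / 2 : ℝ) • (x + x')) ξ) +
      (Complex.I * ((h / 2 : ℝ) : ℂ)) *
        (osc d h (x - x') ξ * bY d h i σ ((1 / 2 : ℝ) • (x + x')) ξ) := by
    funext ξ
    rw [Fi, sth_eq i hs hz]
    ring
  have e2 : (h : ℂ) * ∫ ξ, Fi' d h σ x x' ξ (ev d i) =
      ∫ ξ, osc d h (x - x') ξ * bb d h i σ ((1 / 2 : ℝ) • (x + x')) ξ := by
    rw [← integral_const_mul]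
    congr 1
    funext ξ
    rw [← bb_eq hh, Fi', smul_apply, smul_eq_mul]
    ring
  rw [e1, integral_add (i1.const_mul _) (i2.const_mul _), integral_const_mul, integral_const_mul,
    hI, e0, hz1, hw1, ← e2]
  simp only [Complex.real_smul]
  push_cast
  generalize (∫ ξ, Fi' d h σ x x' ξ (ev d i)) = A
  field_simp
  linear_combination A * (x.1 - x'.1) * Complex.I_sq

theorem Slab_meas (d : ℕ) (a b : ℝ) : MeasurableSet (Slab d a b) :=
  ((isClosed_le continuous_const continuous_fst).inter
    (isClosed_le continuous_fst continuous_const)).measurableSet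

theorem Slab_eq (d : ℕ) (a b : ℝ) :
    Slab d a b = Set.Icc a b ×ˢ (Set.univ : Set (Ed d)) := by
  ext x
  simp [Slab, Set.mem_prod]

theorem par_meas {d : ℕ} {E : Type} [NormedAddCommGroup E] [NormedSpace ℝ E]
    {g : (ℝ × Ed d) × (ℝ × Ed d) → E} (hg : ContinuousOn g {p | p.1 ∈ HS d}) {a b : ℝ}
    (ha : 0 < a) :
    AEStronglyMeasurable (fun x' => ∫ ξ, g (x', ξ)) (volume.restrict (Slab d a b)) := by
  apply AEStronglyMeasurable.integral_prod_right'
  have e : (volume.restrict (Slab d a b)).prod (volume : Measure (ℝ × Ed d)) =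
      ((volume : Measure (ℝ × Ed d)).prod (volume : Measure (ℝ × Ed d))).restrict
        (Slab d a b ×ˢ Set.univ) := by
    rw [← Measure.prod_restrict, Measure.restrict_univ]
  rw [e]
  refine ContinuousOn.aestronglyMeasurable (hg.mono ?_) ((Slab_meas d a b).prod MeasurableSet.univ)
  rintro p ⟨hp, -⟩
  exact lt_of_lt_of_le ha hp.1

theorem wk_meas {d : ℕ} {h : ℝ} (hh : 0 < h) {σ : (ℝ × Ed d) → (ℝ × Ed d) → ℂ}
    (hs : Sm (HS d) σ) {x : ℝ × Ed d} (hx : 0 < x.1) {a b : ℝ} (ha : 0 < a) :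
    AEStronglyMeasurable (fun x' => weylKernel d h σ x x') (volume.restrict (Slab d a b)) := by
  simp only [wk_eq d hh]
  exact (par_meas (Fi_cont hs hx) ha).const_smul (((2 * π * h) ^ (d + 1))⁻¹ : ℝ)

theorem Kd_meas {d : ℕ} {h : ℝ} {σ : (ℝ × Ed d) → (ℝ × Ed d) → ℂ}
    (hs : Sm (HS d) σ) {x : ℝ × Ed d} (hx : 0 < x.1) {a b : ℝ} (ha : 0 < a) :
    AEStronglyMeasurable (fun x' => Kd d h σ x x') (volume.restrict (Slab d a b)) :=
  (par_meas (Fi'_cont hs hx) ha).const_smul (((2 * π * h) ^ (d + 1))⁻¹ : ℝ)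

theorem weight_int (d : ℕ) (x : ℝ × Ed d) :
    Integrable (fun x' : ℝ × Ed d => (1 + ‖x - x'‖) ^ (-((d : ℝ) + 2))) := by
  have := aux_haar d
  exact (int_weight d).comp_sub_left x

theorem weight_comp (d : ℕ) {x u x' : ℝ × Ed d} {r : ℝ} (hr : 0 ≤ r) (hu : ‖u - x‖ ≤ r) :
    (1 + ‖u - x'‖) ^ (-((d : ℝ) + 2)) ≤
      (1 + r) ^ ((d : ℝ) + 2) * (1 + ‖x - x'‖) ^ (-((d : ℝ) + 2)) := by
  have h1 : 1 + ‖x - x'‖ ≤ (1 + r) * (1 + ‖u - x'‖) := by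
    have h2 : ‖x - x'‖ ≤ ‖u - x‖ + ‖u - x'‖ := by
      calc ‖x - x'‖ = ‖(u - x') - (u - x)‖ := by congr 1; abel
        _ ≤ _ := by rw [add_comm]; exact norm_sub_le _ _
    nlinarith [norm_nonneg (u - x')]
  have p0 : (0 : ℝ) ≤ (d : ℝ) + 2 := by positivity
  have h3 := Real.rpow_le_rpow (by positivity) h1 p0
  rw [Real.mul_rpow (by positivity) (by positivity)] at h3
  rw [Real.rpow_neg (by positivity), Real.rpow_neg (by positivity), ← div_eq_mul_inv,
    le_div_iff₀ (by positivity), inv_mul_le_iff₀ (by positivity)]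
  linarith

theorem H_deriv {d : ℕ} {h : ℝ} (hh : 0 < h) {σ : (ℝ × Ed d) → (ℝ × Ed d) → ℂ}
    (hs : Sm (HS d) σ) (hσ : Bd d σ) {a b : ℝ} (ha : 0 < a) {g : ℝ × Ed d → ℂ}
    (hg : AEStronglyMeasurable g (volume.restrict (Slab d a b))) {B : ℝ}
    (hB : ∀ x' ∈ Slab d a b, ‖g x'‖ ≤ B) {x : ℝ × Ed d} (hx : 0 < x.1) :
    IntegrableOn (fun x' => weylKernel d h σ x x' * g x') (Slab d a b) ∧
    IntegrableOn (fun x' => g x' • Kd d h σ x x') (Slab d a b) ∧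
    HasFDerivAt (fun u => ∫ x' in Slab d a b, weylKernel d h σ u x' * g x')
      (∫ x' in Slab d a b, g x' • Kd d h σ x x') x := by
  have hx2 : 0 < x.1 / 2 := by linarith
  obtain ⟨C, hC0, hC⟩ := kernel_bound hh hs hσ (a := x.1 / 2) (b := 3 * x.1 / 2) (b' := b) hx2 ha
  have hb : ∀ u ∈ Metric.ball x (x.1 / 2), 0 < u.1 := fun u hu => by
    have := (ball_slab hu).1
    linarith
  have hxx : x ∈ Metric.ball x (x.1 / 2) := Metric.mem_ball_self hx2
  have hmem : ∀ᵐ x' ∂(volume.restrict (Slab d a b)), x' ∈ Slab d a b :=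
    ae_restrict_mem (Slab_meas d a b)
  set c := (1 + x.1 / 2) ^ ((d : ℝ) + 2)
  have hw : ∀ u ∈ Metric.ball x (x.1 / 2), ∀ x' : ℝ × Ed d,
      C * (1 + ‖u - x'‖) ^ (-((d : ℝ) + 2)) ≤ C * (c * (1 + ‖x - x'‖) ^ (-((d : ℝ) + 2))) := by
    intro u hu x'
    refine mul_le_mul_of_nonneg_left (weight_comp d hx2.le ?_) hC0
    rw [Metric.mem_ball, dist_eq_norm] at hu
    exact hu.le
  set bd : ℝ × Ed d → ℝ := fun x' => B * (C * (c * (1 + ‖x - x'‖) ^ (-((d : ℝ) + 2)))) with hbd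
  have ibd : Integrable bd (volume.restrict (Slab d a b)) :=
    ((((weight_int d x).const_mul c).const_mul C).const_mul B).restrict
  have hB0 : ∀ x' ∈ Slab d a b, 0 ≤ B := fun x' hx' => (norm_nonneg _).trans (hB x' hx')
  have m1 : ∀ u, 0 < u.1 → AEStronglyMeasurable (fun x' => weylKernel d h σ u x' * g x')
      (volume.restrict (Slab d a b)) := fun u hu => (wk_meas hh hs hu ha).mul hg
  have m2 : AEStronglyMeasurable (fun x' => g x' • Kd d h σ x x')
      (volume.restrict (Slab d a b)) := hg.smul (Kd_meas hs hx ha)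
  have b2 : ∀ u ∈ Metric.ball x (x.1 / 2), ∀ x' ∈ Slab d a b,
      ‖g x' • Kd d h σ u x'‖ ≤ bd x' := by
    intro u hu x' hx'
    rw [norm_smul]
    exact mul_le_mul (hB x' hx') (((hC u (ball_slab hu) x' hx').2).trans (hw u hu x'))
      (norm_nonneg _) (hB0 x' hx')
  have i1 : IntegrableOn (fun x' => weylKernel d h σ x x' * g x') (Slab d a b) := by
    refine ibd.mono' (m1 x hx) ?_
    filter_upwards [hmem] with x' hx'
    rw [norm_mul, mul_comm]
    exact mul_le_mul (hB x' hx') (((hC x (ball_slab hxx) x' hx').1).trans (hw x hxx x'))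
      (norm_nonneg _) (hB0 x' hx')
  have i2 : IntegrableOn (fun x' => g x' • Kd d h σ x x') (Slab d a b) := by
    refine ibd.mono' m2 ?_
    filter_upwards [hmem] with x' hx'
    exact b2 x hxx x' hx'
  refine ⟨i1, i2, ?_⟩
  refine hasFDerivAt_integral_of_dominated_of_fderiv_le (𝕜 := ℝ)
    (F := fun u x' => weylKernel d h σ u x' * g x') (F' := fun u x' => g x' • Kd d h σ u x')
    (s := Metric.ball x (x.1 / 2)) (bound := bd)
    (Metric.ball_mem_nhds x hx2) ?_ i1 m2 ?_ ibd ?_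
  · filter_upwards [Metric.ball_mem_nhds x hx2] with u hu
    exact m1 u (hb u hu)
  · filter_upwards [hmem] with x' hx' u hu
    exact b2 u hu x' hx'
  · filter_upwards [hmem] with x' hx' u hu
    exact (wk_hasFDerivAt hh hs hσ (hb u hu) (lt_of_lt_of_le ha hx'.1)).mul_const (g x')

theorem f_bdd {d : ℕ} {Λ : AddSubgroup (Ed d)} (hΛ : DiscreteTopology Λ)
    {D : Set (Ed d)} (hD : IsAddFundamentalDomain Λ D volume) (hDvol : volume D = 1)
    {f : ℝ × Ed d → ℂ} (hf : Continuous f)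
    (hfper : ∀ k ∈ Λ, ∀ x : ℝ × Ed d, f (x.1, x.2 + k) = f x) (a b : ℝ) :
    ∃ B, ∀ x ∈ Slab d a b, ‖f x‖ ≤ B := by
  obtain ⟨R, hR⟩ := aux_cover d Λ hΛ D hD hDvol
  obtain ⟨B, hB⟩ := (isCompact_Icc.prod (isCompact_closedBall (0 : Ed d) R) :
    IsCompact (Set.Icc a b ×ˢ Metric.closedBall (0 : Ed d) R)).exists_bound_of_continuousOn
      hf.continuousOn
  refine ⟨B, fun x hx => ?_⟩
  obtain ⟨k, hk, hkR⟩ := hR x.2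
  rw [← hfper k hk x]
  exact hB _ ⟨hx, by simpa using hkR⟩

theorem cuspOp_eq {d : ℕ} {Λ : AddSubgroup (Ed d)} (hΛ : DiscreteTopology Λ)
    {D : Set (Ed d)} (hD : IsAddFundamentalDomain Λ D volume) {f : ℝ × Ed d → ℂ}
    (hfper : ∀ k ∈ Λ, ∀ x : ℝ × Ed d, f (x.1, x.2 + k) = f x) {a b : ℝ} (ha : 0 < a)
    (hfsupp : ∀ x : ℝ × Ed d, x.1 < a ∨ b < x.1 → f x = 0) {h : ℝ}
    {τ : (ℝ × Ed d) → (ℝ × Ed d) → ℂ} {x : ℝ × Ed d} (hx : 0 < x.1)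
    (hIntg : IntegrableOn (fun x' => weylKernel d h τ x x' *
      (((x'.1 ^ (((d : ℝ) + 1) / 2))⁻¹ : ℝ) * f x')) (Slab d a b)) :
    cuspOp d Λ D h τ f x = ((x.1 ^ (((d : ℝ) + 1) / 2) : ℝ) : ℂ) *
      ∫ x' in Slab d a b, weylKernel d h τ x x' *
        (((x'.1 ^ (((d : ℝ) + 1) / 2))⁻¹ : ℝ) * f x') := by
  set p := ((d : ℝ) + 1) / 2
  set Φ : ℝ × Ed d → ℂ := fun x' => weylKernel d h τ x x' * (((x'.1 ^ p)⁻¹ : ℝ) * f x') with hΦ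
  rw [Slab_eq] at hIntg ⊢
  rw [← aux_unfold d Λ hΛ D hD (Set.Icc a b) measurableSet_Icc Φ hIntg, ← integral_const_mul]
  have hn : ∀ I : Set ℝ, MeasurableSet I → NullMeasurableSet (I ×ˢ D)
      (volume : Measure (ℝ × Ed d)) := fun I hI => hI.nullMeasurableSet.prod hD.nullMeasurableSet
  have e1 : cuspOp d Λ D h τ f x = ∫ x' in Set.Icc a b ×ˢ D, cuspKernel d Λ h τ x x' * f x' := by
    rw [cuspOp, cusp]
    refine setIntegral_eq_of_subset_of_ae_sdiff_eq_zero (hn _ measurableSet_Ioi) ?_ ?_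
    · exact Set.prod_mono (fun y hy => lt_of_lt_of_le ha hy.1) le_rfl
    · refine ae_of_all _ fun x' hx' => ?_
      have : x'.1 < a ∨ b < x'.1 := by
        by_contra hcon
        push Not at hcon
        exact hx'.2 ⟨hcon, hx'.1.2⟩
      rw [hfsupp x' this, mul_zero]
  rw [e1]
  refine integral_congr_ae ?_
  filter_upwards [ae_restrict_mem₀ (hn _ measurableSet_Icc)] with x' hx'
  have hx0 : 0 < x'.1 := lt_of_lt_of_le ha hx'.1.1
  have e2 : ∀ k : Λ, Φ (x'.1, x'.2 + k) =
      weylKernel d h τ x (x'.1, x'.2 + k) * (((x'.1 ^ p)⁻¹ : ℝ) * f x') := by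
    intro k
    simp only [hΦ]
    rw [hfper k k.2]
  simp only [e2]
  rw [tsum_mul_right, cuspKernel, Real.div_rpow hx.le hx0.le, Complex.real_smul]
  simp only [p, div_eq_mul_inv]
  push_cast
  ring

theorem main_thm (d : ℕ) (Λ : AddSubgroup (Ed d)) (hΛ : DiscreteTopology Λ)
    (D : Set (Ed d)) (hD : IsAddFundamentalDomain Λ D volume) (hDvol : volume D = 1)
    (σ : (ℝ × Ed d) → (ℝ × Ed d) → ℂ)
    (hs : Sm (HS d) σ) (hσ : Bd d σ)
    (h : ℝ) (hh : 0 < h) (i : Fin d)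
    (f : ℝ × Ed d → ℂ) (hf : Continuous f)
    (hfper : ∀ k ∈ Λ, ∀ x : ℝ × Ed d, f (x.1, x.2 + k) = f x)
    (hfsupp : ∃ c₁ c₂ : ℝ, 0 < c₁ ∧ ∀ x : ℝ × Ed d, x.1 < c₁ ∨ c₂ < x.1 → f x = 0)
    (x : ℝ × Ed d) (hx : 0 < x.1) :
    ((h * x.1 : ℝ) : ℂ) * fderiv ℝ (cuspOp d Λ D h σ f) x (ev d i) =
      cuspOp d Λ D h (sth d h i σ) f x := by
  obtain ⟨a, b, ha, hsupp⟩ := hfsupp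
  obtain ⟨B, hB⟩ := f_bdd hΛ hD hDvol hf hfper a b
  set p := ((d : ℝ) + 1) / 2 with hp
  have hp0 : 0 ≤ p := by positivity
  set g : ℝ × Ed d → ℂ := fun x' => ((x'.1 ^ p)⁻¹ : ℝ) * f x' with hg
  have hgB : ∀ x' ∈ Slab d a b, ‖g x'‖ ≤ (a ^ p)⁻¹ * B := by
    intro x' hx'
    have hx0 : 0 < x'.1 := lt_of_lt_of_le ha hx'.1
    rw [hg]
    simp only [norm_mul, Complex.norm_real]
    rw [Real.norm_of_nonneg (by positivity)]
    refine mul_le_mul ?_ (hB x' hx') (norm_nonneg _) (by positivity)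
    exact inv_anti₀ (by positivity) (Real.rpow_le_rpow ha.le hx'.1 hp0)
  have hgc : ContinuousOn g (Slab d a b) := by
    refine ContinuousOn.mul ?_ hf.continuousOn
    refine Complex.continuous_ofReal.comp_continuousOn ?_
    refine ContinuousOn.inv₀ ?_ ?_
    · exact continuous_fst.continuousOn.rpow_const (fun _ _ => Or.inr hp0)
    · intro x' hx'
      have hx0 : 0 < x'.1 := lt_of_lt_of_le ha hx'.1
      positivity
  have hgm : AEStronglyMeasurable g (volume.restrict (Slab d a b)) :=
    hgc.aestronglyMeasurable (Slab_meas d a b)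
  obtain ⟨-, i2, hH⟩ := H_deriv hh hs hσ ha hgm hgB hx
  have hev : cuspOp d Λ D h σ f =ᶠ[𝓝 x] fun u => ((u.1 ^ p : ℝ) : ℂ) *
      ∫ x' in Slab d a b, weylKernel d h σ u x' * g x' := by
    filter_upwards [(HS_open d).mem_nhds hx] with u hu
    exact cuspOp_eq hΛ hD hfper ha hsupp hu (H_deriv hh hs hσ ha hgm hgB hu).1
  have h1 : HasFDerivAt (fun u : ℝ × Ed d => ((u.1 ^ p : ℝ) : ℂ))
      (Complex.ofRealCLM.comp ((p * x.1 ^ (p - 1)) • ContinuousLinearMap.fst ℝ ℝ (Ed d))) x :=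
    Complex.ofRealCLM.hasFDerivAt.comp x
      ((hasFDerivAt_fst (𝕜 := ℝ) (p := x)).rpow_const (Or.inl hx.ne'))
  have h2 := h1.mul hH
  rw [hev.fderiv_eq]
  have h3 : fderiv ℝ (fun u => ((u.1 ^ p : ℝ) : ℂ) *
      ∫ x' in Slab d a b, weylKernel d h σ u x' * g x') x (ev d i) =
      ((x.1 ^ p : ℝ) : ℂ) * ∫ x' in Slab d a b, g x' * Kd d h σ x x' (ev d i) := by
    have h4 := h2.fderiv
    have h5 : (∫ x' in Slab d a b, g x' • Kd d h σ x x') (ev d i) =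
        ∫ x' in Slab d a b, g x' * Kd d h σ x x' (ev d i) :=
      ContinuousLinearMap.integral_apply i2 _
    rw [← h5]
    refine (congrArg (fun L : (ℝ × Ed d) →L[ℝ] ℂ => L (ev d i)) h4).trans ?_
    simp [ev]
  rw [h3]
  have hk : ∀ x' ∈ Slab d a b, weylKernel d h (sth d h i σ) x x' * g x' =
      ((h * x.1 : ℝ) : ℂ) * (g x' * Kd d h σ x x' (ev d i)) := by
    intro x' hx'
    rw [← ker_id hh i hs hσ hx (lt_of_lt_of_le ha hx'.1)]
    ring
  have i3 : IntegrableOn (fun x' => weylKernel d h (sth d h i σ) x x' * g x') (Slab d a b) := by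
    have i4 : IntegrableOn (fun x' => ((h * x.1 : ℝ) : ℂ) * (g x' * Kd d h σ x x' (ev d i)))
      (Slab d a b) := (i2.apply_continuousLinearMap (ev d i)).const_mul _
    exact i4.congr_fun (fun x' hx' => (hk x' hx').symm) (Slab_meas d a b)
  rw [cuspOp_eq hΛ hD hfper ha hsupp hx i3, setIntegral_congr_fun (Slab_meas d a b) hk,
    integral_const_mul]
  ring

end helpers

/-- **Exact composition with the horizontal derivative.** For a symbol `σ`
of order `-∞` on the cusp, `(h y ∂_{θ_i}) ∘ Op_h(σ) = Op_h(σ_θ)` on `C_c^∞(Z_Λ)`, where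
`σ_θ = i y J_i σ - (h/2) J_i ∂_Y σ + (h/2) y ∂_{θ_i} σ + i (h²/4) ∂_{θ_i} ∂_Y σ`. -/
theorem stmt9 (d : ℕ) (hd : 1 ≤ d) (Λ : AddSubgroup (Ed d)) (hΛ : DiscreteTopology Λ)
    (D : Set (Ed d)) (hD : IsAddFundamentalDomain Λ D volume) (hDvol : volume D = 1)
    (σ : (ℝ × Ed d) → (ℝ × Ed d) → ℂ)
    (hper : ∀ k ∈ Λ, ∀ (x : ℝ × Ed d) (ξ : ℝ × Ed d), σ (x.1, x.2 + k) ξ = σ x ξ)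
    (hsmooth : ContDiffOn ℝ (⊤ : ℕ∞) (fun p : (ℝ × Ed d) × (ℝ × Ed d) => σ p.1 p.2)
      {p : (ℝ × Ed d) × (ℝ × Ed d) | 0 < p.1.1})
    (hbounds : ∀ (bx bξ : ℕ) (M : ℝ), ∃ C : ℝ, 0 < C ∧
      ∀ x : ℝ × Ed d, 0 < x.1 → ∀ ξ : ℝ × Ed d,
        ‖iteratedFDeriv ℝ bx
            (fun u : ℝ × Ed d => iteratedFDeriv ℝ bξ (fun v : ℝ × Ed d => σ u v) ξ) x‖ ≤
          C * x.1 ^ ((bx : ℝ) - (bξ : ℝ)) * (1 + x.1 * xiNorm d ξ) ^ (-M))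
    (h : ℝ) (hh : 0 < h) (i : Fin d)
    (f : ℝ × Ed d → ℂ) (hfreg : ContDiff ℝ (⊤ : ℕ∞) f)
    (hfper : ∀ k ∈ Λ, ∀ x : ℝ × Ed d, f (x.1, x.2 + k) = f x)
    (hfsupp : ∃ c₁ c₂ : ℝ, 0 < c₁ ∧ ∀ x : ℝ × Ed d, x.1 < c₁ ∨ c₂ < x.1 → f x = 0)
    (x : ℝ × Ed d) (hx : 0 < x.1) :
    ((h * x.1 : ℝ) : ℂ) *
        fderiv ℝ (cuspOp d Λ D h σ f) x ((0 : ℝ), (EuclideanSpace.single i (1 : ℝ) : Ed d)) =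
      cuspOp d Λ D h
        (fun z ξ =>
          Complex.I * ((z.1 * ξ.2 i : ℝ) : ℂ) * σ z ξ
            - ((h / 2 : ℝ) : ℂ) * ((ξ.2 i : ℝ) : ℂ) *
                fderiv ℝ (σ z) ξ ((1 : ℝ), (0 : Ed d))
            + ((h / 2 : ℝ) : ℂ) * ((z.1 : ℝ) : ℂ) *
                fderiv ℝ (fun w : ℝ × Ed d => σ w ξ) z
                  ((0 : ℝ), (EuclideanSpace.single i (1 : ℝ) : Ed d))
            + Complex.I * ((h ^ 2 / 4 : ℝ) : ℂ) *
                fderiv ℝ (fun w : ℝ × Ed d => fderiv ℝ (σ w) ξ ((1 : ℝ), (0 : Ed d))) z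
                  ((0 : ℝ), (EuclideanSpace.single i (1 : ℝ) : Ed d)))
        f x := by
  exact main_thm d Λ hΛ D hD hDvol σ hsmooth hbounds h hh i f hfreg.continuous hfper hfsupp x hx
end
end

section
/- (Formal adjoint of the cusp quantization.) Let σ : ℍ^{d+1} × ℝ^{d+1} → ℂ be Λ-periodic in θ, C^{d+2} in the J-variables, and satisfy for every multi-index α in the J-variables with |α| ≤ d+2: |∂_J^α σ(x,ξ)| ≤ C y^{-|α|} (1 + y|ξ|)^{-(d+2)}. Then for every h > 0 and all f, g ∈ C_c^∞(Z_Λ): ⟨Op_h(σ) f, g⟩_{L²(Z_Λ)} = ⟨f, Op_h(σ̄) g⟩_{L²(Z_Λ)}, where σ̄ is the complex conjugate of σ. In particular, if σ is real-valued then Op_h(σ) is symmetric on C_c^∞(Z_Λ). -/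
open MeasureTheory Real Filter
open scoped RealInnerProductSpace ENNReal NNReal Topology

noncomputable section

/-- The `L²(Z_Λ)` inner product `⟨f,g⟩ = ∫ f ḡ y^{-(d+1)} dy dθ`. -/
def cuspInner (d : ℕ) (D : Set (Ed d)) (f g : ℝ × Ed d → ℂ) : ℂ :=
  ∫ x in cusp d D, f x * (starRingEnd ℂ) (g x) * ((x.1 ^ (-((d : ℝ) + 1)) : ℝ) : ℂ)

lemma lat_span (d : ℕ) (Λ : AddSubgroup (Ed d)) (hΛ : DiscreteTopology Λ)
    (D : Set (Ed d)) (hD : IsAddFundamentalDomain Λ D volume) (hDvol : volume D = 1) :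
    Submodule.span ℝ (Λ : Set (Ed d)) = ⊤ := by
  by_contra hne
  set V := Submodule.span ℝ (Λ : Set (Ed d)) with hV
  have hperp : Vᗮ ≠ ⊥ := by
    intro h; exact hne (Submodule.orthogonal_eq_bot_iff.1 h)
  obtain ⟨w, hwV, hw0⟩ := Submodule.exists_mem_ne_zero_of_ne_bot hperp
  have hw : 0 < ‖w‖ := norm_pos_iff.2 hw0
  obtain ⟨ε, hε, hsep⟩ : ∃ ε > 0, ∀ k ∈ Λ, ‖k‖ < ε → k = 0 := by
    have h1 : ({0} : Set Λ) ∈ 𝓝 (0 : Λ) := (isOpen_discrete _).mem_nhds rfl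
    obtain ⟨ε, hε, hb⟩ := Metric.mem_nhds_iff.1 h1
    refine ⟨ε, hε, fun k hk hn => ?_⟩
    have : (⟨k, hk⟩ : Λ) ∈ Metric.ball (0 : Λ) ε := by
      simpa [Metric.mem_ball, dist_eq_norm] using hn
    have := hb this
    simpa using congrArg Subtype.val this
  have hcount : Countable Λ := by
    have : SecondCountableTopology Λ := inferInstance
    exact TopologicalSpace.separableSpace_iff_countable.1 inferInstance
  set δ := min (ε / 2) (‖w‖ / 2) with hδ
  have hδ0 : 0 < δ := by positivity
  set S : Set (Ed d) := ⋃ n : ℕ, Metric.ball ((n : ℝ) • w) δ with hS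
  have hSm : MeasurableSet S := MeasurableSet.iUnion fun n => measurableSet_ball
  have hvol : volume S = ⊤ := by
    rw [hS, measure_iUnion _ (fun n => measurableSet_ball)]
    · have : ∀ n : ℕ, volume (Metric.ball ((n : ℝ) • w) δ) = volume (Metric.ball (0 : Ed d) δ) :=
        fun n => Measure.addHaar_ball_center _ _ _
      simp_rw [this]
      exact ENNReal.tsum_const_eq_top_of_ne_zero (Metric.measure_ball_pos volume (0 : Ed d) hδ0).ne'
    · intro n m hnm
      apply Metric.ball_disjoint_ball
      rw [dist_eq_norm, ← sub_smul, norm_smul]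
      have : (1 : ℝ) ≤ ‖(n : ℝ) - m‖ := by
        rw [Real.norm_eq_abs]
        have : (1 : ℤ) ≤ |(n : ℤ) - m| := Int.one_le_abs (by omega)
        exact_mod_cast this
      have h2 : δ ≤ ‖w‖ / 2 := min_le_right _ _
      nlinarith
  obtain ⟨x, y, hxy, hnd⟩ := exists_pair_mem_lattice_not_disjoint_vadd hD hSm.nullMeasurableSet
    (by rw [hvol, hDvol]; exact ENNReal.one_lt_top)
  obtain ⟨_, ⟨v, hv, rfl⟩, u, hu, hvu⟩ := Set.not_disjoint_iff.mp hnd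
  simp only [hS, Set.mem_iUnion, Metric.mem_ball, dist_eq_norm] at hv hu
  obtain ⟨n, hn⟩ := hv
  obtain ⟨m, hm⟩ := hu
  have hkey : (x : Ed d) + v = y + u := by
    simpa [AddSubgroup.vadd_def] using hvu.symm
  apply hxy
  have hmem : ((x - y : Λ) : Ed d) ∈ V := Submodule.subset_span (x - y).2
  have horth : ⟪((x - y : Λ) : Ed d), w⟫ = 0 := (Submodule.mem_orthogonal V w).1 hwV _ hmem
  have hdec : ((x - y : Λ) : Ed d) - ((m : ℝ) - n) • w = (u - (m : ℝ) • w) - (v - (n : ℝ) • w) := by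
    have : ((x - y : Λ) : Ed d) = u - v := by
      rw [AddSubgroup.coe_sub, sub_eq_sub_iff_add_eq_add, hkey]; abel
    rw [this, sub_smul]; abel
  have hlt : ‖((x - y : Λ) : Ed d) - ((m : ℝ) - n) • w‖ < ε := by
    rw [hdec]
    have h2 : δ ≤ ε / 2 := min_le_left _ _
    calc _ ≤ _ := norm_sub_le _ _
      _ < ε := by linarith
  have hle : ‖((x - y : Λ) : Ed d)‖ ≤ ‖((x - y : Λ) : Ed d) - ((m : ℝ) - n) • w‖ := by
    have := norm_sub_sq_real ((x - y : Λ) : Ed d) (((m : ℝ) - n) • w)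
    rw [inner_smul_right, horth] at this
    apply le_of_sq_le_sq _ (norm_nonneg _)
    nlinarith [sq_nonneg ‖((m : ℝ) - n) • w‖]
  have := hsep _ (x - y).2 (hle.trans_lt hlt)
  have h0 : x - y = 0 := Subtype.ext this
  exact sub_eq_zero.1 h0

lemma per_bdd (d : ℕ) (Λ : AddSubgroup (Ed d)) (hΛ : DiscreteTopology Λ)
    (D : Set (Ed d)) (hD : IsAddFundamentalDomain Λ D volume) (hDvol : volume D = 1)
    (f : ℝ × Ed d → ℂ) (hf : Continuous f)
    (hfper : ∀ k ∈ Λ, ∀ x : ℝ × Ed d, f (x.1, x.2 + k) = f x)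
    (c₁ c₂ : ℝ) (hs : ∀ x : ℝ × Ed d, x.1 < c₁ ∨ c₂ < x.1 → f x = 0) :
    ∃ M, 0 ≤ M ∧ ∀ x, ‖f x‖ ≤ M := by
  let L : Submodule ℤ (Ed d) := AddSubgroup.toIntSubmodule Λ
  have : DiscreteTopology L := hΛ
  have : IsZLattice ℝ L := ⟨lat_span d Λ hΛ D hD hDvol⟩
  let b := (Module.Free.chooseBasis ℤ L).ofZLatticeBasis ℝ
  have hspan : Submodule.span ℤ (Set.range b) = L := 
    (Module.Free.chooseBasis ℤ L).ofZLatticeBasis_span ℝ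
  obtain ⟨R, hR⟩ := (ZSpan.fundamentalDomain_isBounded b).subset_closedBall 0
  have hK : IsCompact (Set.Icc c₁ c₂ ×ˢ Metric.closedBall (0 : Ed d) R) :=
    isCompact_Icc.prod (isCompact_closedBall _ _)
  obtain ⟨M, hM⟩ := hK.exists_bound_of_continuousOn hf.continuousOn
  refine ⟨max M 0, le_max_right _ _, fun x => ?_⟩
  by_cases hx : x.1 < c₁ ∨ c₂ < x.1
  · rw [hs x hx]; simp
  push Not at hx
  have hfl : (ZSpan.floor b x.2 : Ed d) ∈ Λ := by
    have := (ZSpan.floor b x.2).2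
    exact hspan.le this
  have hp := hfper _ hfl (x.1, ZSpan.fract b x.2)
  rw [ZSpan.fract_apply] at hp
  simp only [sub_add_cancel] at hp
  rw [show f x = f (x.1, x.2) from rfl, hp]
  refine (hM (x.1, x.2 - (ZSpan.floor b x.2 : Ed d)) ⟨⟨hx.1, hx.2⟩, ?_⟩).trans (le_max_left _ _)
  exact hR (ZSpan.fract_mem_fundamentalDomain b x.2)

lemma symb_bound (d : ℕ) (σ : (ℝ × Ed d) → (ℝ × Ed d) → ℂ) (C : ℝ)
    (hbound : ∀ m : ℕ, m ≤ d + 2 → ∀ x : ℝ × Ed d, 0 < x.1 → ∀ (Y : ℝ) (J : Ed d),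
      ‖iteratedFDeriv ℝ m (fun J : Ed d => σ x (Y, J)) J‖ ≤
        C * x.1 ^ (-(m : ℝ)) * (1 + x.1 * xiNorm d (Y, J)) ^ (-((d : ℝ) + 2)))
    (c : ℝ) (hc : 0 < c) :
    ∃ A : ℝ, 0 ≤ A ∧ ∀ m : ℕ, m ≤ d + 2 → ∀ x : ℝ × Ed d, c ≤ x.1 → ∀ (Y : ℝ) (J : Ed d),
      ‖iteratedFDeriv ℝ m (fun J : Ed d => σ x (Y, J)) J‖ ≤
        A * (1 + ‖(Y, J)‖) ^ (-((d : ℝ) + 2)) := by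
  have hC : 0 ≤ C := by
    have := (norm_nonneg _).trans (hbound 0 (by omega) ((1 : ℝ), 0) one_pos 0 0)
    simpa [xiNorm] using this
  set q := max 1 c⁻¹ with hq
  have hq1 : 1 ≤ q := le_max_left _ _
  have hq0 : 0 < q := by linarith
  have hqc : q⁻¹ ≤ c := by
    rw [inv_le_comm₀ hq0 hc]; exact le_max_right _ _
  refine ⟨C * q ^ (d + 2) * q ^ ((d : ℝ) + 2), by positivity, fun m hm x hx Y J => ?_⟩
  have hx0 : 0 < x.1 := hc.trans_le hx
  refine (hbound m hm x hx0 Y J).trans ?_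
  rw [mul_assoc (C * q ^ (d + 2))]
  have hxi : ‖(Y, J)‖ ≤ xiNorm d (Y, J) := by
    rw [xiNorm, Prod.norm_def]
    apply max_le
    · apply Real.le_sqrt_of_sq_le; simp [sq_nonneg]
    · apply Real.le_sqrt_of_sq_le; simp [sq_nonneg]
  have hxin : 0 ≤ xiNorm d (Y, J) := Real.sqrt_nonneg _
  have h1 : x.1 ^ (-(m : ℝ)) ≤ q ^ (d + 2) := by
    rw [Real.rpow_neg hx0.le, Real.rpow_natCast, ← inv_pow]
    have : x.1⁻¹ ≤ q := (inv_anti₀ hc hx).trans (le_max_right _ _)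
    exact (pow_le_pow_left₀ (by positivity) this m).trans (pow_le_pow_right₀ hq1 hm)
  have h2 : (1 + x.1 * xiNorm d (Y, J)) ^ (-((d : ℝ) + 2)) ≤
      q ^ ((d : ℝ) + 2) * (1 + ‖(Y, J)‖) ^ (-((d : ℝ) + 2)) := by
    have h3 : q⁻¹ * (1 + ‖(Y, J)‖) ≤ 1 + x.1 * xiNorm d (Y, J) := by
      have : q⁻¹ ≤ 1 := inv_le_one_of_one_le₀ hq1
      have h4 : q⁻¹ * ‖(Y, J)‖ ≤ x.1 * xiNorm d (Y, J) :=
        mul_le_mul (hqc.trans hx) hxi (norm_nonneg _) hx0.le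
      linarith
    have h5 : (1 + x.1 * xiNorm d (Y, J)) ^ (-((d : ℝ) + 2)) ≤
        (q⁻¹ * (1 + ‖(Y, J)‖)) ^ (-((d : ℝ) + 2)) :=
      Real.rpow_le_rpow_of_nonpos (by positivity) h3 (by linarith [Nat.cast_nonneg (α := ℝ) d])
    refine h5.trans (le_of_eq ?_)
    rw [Real.mul_rpow (by positivity) (by positivity), Real.inv_rpow hq0.le, Real.rpow_neg hq0.le,
      inv_inv]
  gcongr

lemma fourier_decay (d : ℕ) (a : Ed d → ℂ) (ha : ContDiff ℝ (d + 2) a) (B : Ed d → ℝ)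
    (hB : Integrable B)
    (hab : ∀ m : ℕ, m ≤ d + 2 → ∀ J, ‖iteratedFDeriv ℝ m a J‖ ≤ B J) (w : Ed d) :
    (1 + ‖w‖ ^ (d + 1)) * ‖∫ J, Complex.exp ((↑(-2 * π * ⟪J, w⟫) * Complex.I)) • a J‖ ≤
      (1 + 2 ^ (d + 1) * (d + 2)) * ∫ J, B J := by
  have hIntg : ∀ m : ℕ, m ≤ d + 2 → Integrable (fun v => ‖iteratedFDeriv ℝ m a v‖) := by
    intro m hm
    refine hB.mono' ?_ (Eventually.of_forall fun J => by simpa using hab m hm J)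
    exact (ha.continuous_iteratedFDeriv (by exact_mod_cast hm)).norm.aestronglyMeasurable
  rw [← Real.fourier_eq', add_mul, add_mul, one_mul, one_mul]
  apply add_le_add
  · rw [Real.fourier_eq']
    refine (norm_integral_le_integral_norm _).trans (integral_mono_of_nonneg ?_ hB ?_)
    · exact Eventually.of_forall fun J => norm_nonneg _
    · refine Eventually.of_forall fun J => ?_
      have := hab 0 (by omega) J
      simp only [norm_iteratedFDeriv_zero] at this
      simp only [norm_smul, Complex.norm_exp_ofReal_mul_I, one_mul]
      exact this
  · have := Real.pow_mul_norm_iteratedFDeriv_fourier_le (K := 0) (N := ((d + 2 : ℕ) : ℕ∞)) (f := a)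
      (by exact_mod_cast ha) (by
        intro k n hk hn
        have hk0 : k = 0 := by simpa using hk
        subst hk0
        simpa using hIntg n (by exact_mod_cast hn)) (k := 0) (n := d + 1) (by simp)
        (by exact_mod_cast (by omega : d + 1 ≤ d + 2)) w
    simp only [norm_iteratedFDeriv_zero, pow_zero, one_mul, CharP.cast_eq_zero, mul_zero,
      zero_add, Finset.range_one, Finset.sum_product, Finset.sum_singleton] at this
    refine this.trans ?_
    rw [mul_assoc]
    gcongr
    calc _ ≤ ∑ p ∈ Finset.range (d + 1 + 1), ∫ J, B J := by
          refine Finset.sum_le_sum fun p hp => ?_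
          have hp' : p ≤ d + 2 := by have := Finset.mem_range.1 hp; omega
          exact integral_mono (hIntg p hp') hB (hab p hp')
      _ = _ := by simp; left; ring

lemma weyl_decay (d : ℕ) (σ : (ℝ × Ed d) → (ℝ × Ed d) → ℂ)
    (hmeas : Measurable fun p : (ℝ × Ed d) × (ℝ × Ed d) => σ p.1 p.2)
    (hreg : ∀ (x : ℝ × Ed d) (Y : ℝ), ContDiff ℝ (d + 2) fun J : Ed d => σ x (Y, J))
    (C : ℝ)
    (hbound : ∀ m : ℕ, m ≤ d + 2 → ∀ x : ℝ × Ed d, 0 < x.1 → ∀ (Y : ℝ) (J : Ed d),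
      ‖iteratedFDeriv ℝ m (fun J : Ed d => σ x (Y, J)) J‖ ≤
        C * x.1 ^ (-(m : ℝ)) * (1 + x.1 * xiNorm d (Y, J)) ^ (-((d : ℝ) + 2)))
    (h : ℝ) (hh : 0 < h) (c : ℝ) (hc : 0 < c) :
    ∃ M : ℝ, 0 ≤ M ∧ ∀ x x' : ℝ × Ed d, c ≤ x.1 → c ≤ x'.1 →
      ‖weylKernel d h σ x x'‖ ≤ M * (1 + ‖x.2 - x'.2‖) ^ (-((d : ℝ) + 1)) := by
  obtain ⟨A, hA, hAb⟩ := symb_bound d σ C hbound c hc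
  set G : ℝ × Ed d → ℝ := fun ξ => A * (1 + ‖ξ‖) ^ (-((d : ℝ) + 2)) with hG
  have hGi : Integrable G := by
    have : (volume : Measure (ℝ × Ed d)).IsAddHaarMeasure := by
      rw [Measure.volume_eq_prod]; infer_instance
    refine (integrable_one_add_norm (E := ℝ × Ed d) ?_).const_mul A
    simp [Module.finrank_prod]; linarith
  have hGJ : ∀ Y : ℝ, Integrable fun J : Ed d => G (Y, J) := by
    intro Y
    have h1 : Integrable fun J : Ed d => A * (1 + ‖J‖) ^ (-((d : ℝ) + 2)) := by
      refine (integrable_one_add_norm ?_).const_mul A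
      simp
    refine h1.mono' ?_ (Eventually.of_forall fun J => ?_)
    · apply Continuous.aestronglyMeasurable
      apply continuous_const.mul
      refine Continuous.rpow_const (by fun_prop) (fun J => Or.inl ?_)
      positivity
    · rw [Real.norm_of_nonneg (by positivity)]
      refine mul_le_mul_of_nonneg_left ?_ hA
      refine Real.rpow_le_rpow_of_nonpos (by positivity) ?_ (by linarith [Nat.cast_nonneg (α := ℝ) d])
      have : ‖J‖ ≤ ‖(Y, J)‖ := norm_snd_le (Y, J)
      linarith
  have hG0 : ∀ ξ, 0 ≤ G ξ := fun ξ => by positivity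
  set K : ℝ := 1 + 2 ^ (d + 1) * (d + 2) with hK
  have hI : ∀ x x' : ℝ × Ed d, c ≤ x.1 → c ≤ x'.1 →
      (1 + ‖(-(2 * π * h)⁻¹) • (x.2 - x'.2)‖ ^ (d + 1)) * ‖∫ ξ : ℝ × Ed d,
      Complex.exp (Complex.I * Complex.ofReal (epair d (x - x') ξ / h)) *
        σ ((1 / 2 : ℝ) • (x + x')) ξ‖ ≤ K * ∫ ξ, G ξ := by
    intro x x' hx hx'
    set X := (1 / 2 : ℝ) • (x + x') with hX
    have hXc : c ≤ X.1 := by simp [hX]; linarith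
    set w := (-(2 * π * h)⁻¹) • (x.2 - x'.2) with hw
    have hsm : Measurable (σ X) := hmeas.comp (measurable_const.prodMk measurable_id)
    have hsb : ∀ ξ, ‖σ X ξ‖ ≤ G ξ := fun ξ => by
      have := hAb 0 (by omega) X hXc ξ.1 ξ.2
      simpa only [norm_iteratedFDeriv_zero] using this
    have hfi : Integrable (fun ξ : ℝ × Ed d =>
        Complex.exp (Complex.I * Complex.ofReal (epair d (x - x') ξ / h)) * σ X ξ) := by
      refine hGi.mono' ?_ (Eventually.of_forall fun ξ => ?_)
      · refine (Continuous.aestronglyMeasurable ?_).mul hsm.aestronglyMeasurable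
        unfold epair; fun_prop
      · rw [norm_mul, mul_comm Complex.I, Complex.norm_exp_ofReal_mul_I, one_mul]
        exact hsb ξ
    rw [Measure.volume_eq_prod, integral_prod _ (by rwa [← Measure.volume_eq_prod])]
    have hin : ∀ Y : ℝ, ∫ J : Ed d, 
        Complex.exp (Complex.I * Complex.ofReal (epair d (x - x') (Y, J) / h)) * σ X (Y, J) =
        Complex.exp (Complex.ofReal ((x.1 - x'.1) * Y / h) * Complex.I) *
        ∫ J : Ed d, Complex.exp ((↑(-2 * π * ⟪J, w⟫) * Complex.I)) • σ X (Y, J) := by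
      intro Y
      rw [← integral_const_mul]
      congr 1
      ext J
      rw [smul_eq_mul, ← mul_assoc, ← Complex.exp_add]
      congr 2
      rw [mul_comm Complex.I, ← add_mul, ← Complex.ofReal_add]
      congr 2
      rw [hw, inner_smul_right, epair, real_inner_comm]
      have := Real.pi_pos
      simp only [Prod.fst_sub, Prod.snd_sub]
      field_simp
    simp_rw [hin]
    have hGp : Integrable G ((volume : Measure ℝ).prod (volume : Measure (Ed d))) := by
      rwa [← Measure.volume_eq_prod]
    rw [integral_prod _ hGp]
    have hpos : 0 < 1 + ‖w‖ ^ (d + 1) := by positivity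
    rw [← integral_const_mul]
    rw [← le_div_iff₀' hpos, ← integral_div]
    refine (norm_integral_le_integral_norm _).trans (integral_mono_of_nonneg ?_ ?_ ?_)
    · exact Eventually.of_forall fun J => norm_nonneg _
    · exact (hGp.integral_prod_left.const_mul K).div_const _
    · refine Eventually.of_forall fun Y => ?_
      simp only [norm_mul, Complex.norm_exp_ofReal_mul_I, one_mul]
      rw [le_div_iff₀' hpos]
      exact fourier_decay d _ (hreg X Y) (fun J => G (Y, J)) (hGJ Y)
        (fun m hm J => hAb m hm X hXc Y J) w
  have hGn : 0 ≤ ∫ ξ, G ξ := integral_nonneg hG0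
  have hK0 : 0 ≤ K := by positivity
  have hph : 0 < 2 * π * h := by have := Real.pi_pos; positivity
  refine ⟨((2 * π * h) ^ (d + 1))⁻¹ * (2 ^ d * (1 + (2 * π * h) ^ (d + 1)) * (K * ∫ ξ, G ξ)),
    by positivity, fun x x' hx hx' => ?_⟩
  have hmain := hI x x' hx hx'
  rw [weylKernel, norm_smul, mul_assoc ((2 * π * h) ^ (d + 1))⁻¹,
    Real.norm_of_nonneg (by positivity : (0:ℝ) ≤ ((2 * π * h) ^ (d + 1))⁻¹)]
  refine mul_le_mul_of_nonneg_left ?_ (by positivity)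
  set I := ‖∫ ξ : ℝ × Ed d, Complex.exp (Complex.I * Complex.ofReal (epair d (x - x') ξ / h)) *
        σ ((1 / 2 : ℝ) • (x + x')) ξ‖ with hIdef
  have hI0 : 0 ≤ I := norm_nonneg _
  rw [Real.rpow_neg (by positivity : (0:ℝ) ≤ 1 + ‖x.2 - x'.2‖), ← div_eq_mul_inv, le_div_iff₀ (by positivity)]
  have hcast : (1 + ‖x.2 - x'.2‖) ^ ((d : ℝ) + 1) = (1 + ‖x.2 - x'.2‖) ^ (d + 1) := by
    exact_mod_cast Real.rpow_natCast (1 + ‖x.2 - x'.2‖) (d + 1)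
  rw [hcast]
  rw [norm_smul, norm_neg, norm_inv, Real.norm_of_nonneg hph.le, mul_pow, inv_pow] at hmain
  have hadd := add_pow_le (by norm_num : (0:ℝ) ≤ 1) (norm_nonneg (x.2 - x'.2)) (d + 1)
  simp only [one_pow, Nat.add_sub_cancel] at hadd
  set P := (2 * π * h) ^ (d + 1) with hP
  have hP0 : 0 < P := by positivity
  set z := ‖x.2 - x'.2‖ ^ (d + 1) with hz
  have hz0 : 0 ≤ z := by positivity
  have h3 : 1 + z ≤ (1 + P) * (1 + P⁻¹ * z) := by
    have : (1 + P) * (1 + P⁻¹ * z) = 1 + z + P + P⁻¹ * z := by field_simp; ring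
    rw [this]; have : 0 ≤ P⁻¹ * z := by positivity
    linarith
  calc I * (1 + ‖x.2 - x'.2‖) ^ (d + 1) ≤ I * (2 ^ d * ((1 + P) * (1 + P⁻¹ * z))) := by
        refine mul_le_mul_of_nonneg_left (hadd.trans ?_) hI0
        gcongr
    _ = 2 ^ d * (1 + P) * ((1 + P⁻¹ * z) * I) := by ring
    _ ≤ _ := by gcongr

lemma weyl_conj (d : ℕ) (h : ℝ) (σ : (ℝ × Ed d) → (ℝ × Ed d) → ℂ) (x x' : ℝ × Ed d) :
    (starRingEnd ℂ) (weylKernel d h (fun z ξ => (starRingEnd ℂ) (σ z ξ)) x' x) =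
      weylKernel d h σ x x' := by
  unfold weylKernel
  rw [Complex.real_smul, Complex.real_smul, map_mul, Complex.conj_ofReal, ← integral_conj]
  congr 2
  ext ξ
  rw [map_mul, Complex.conj_conj, ← Complex.exp_conj, map_mul, Complex.conj_I, Complex.conj_ofReal,
    add_comm x' x]
  congr 2
  have : epair d (x' - x) ξ = - epair d (x - x') ξ := by
    unfold epair
    simp only [Prod.fst_sub, Prod.snd_sub, inner_sub_left]; ring
  rw [this]; push_cast; ring

lemma weyl_shift (d : ℕ) (Λ : AddSubgroup (Ed d)) (h : ℝ) (σ : (ℝ × Ed d) → (ℝ × Ed d) → ℂ)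
    (hper : ∀ k ∈ Λ, ∀ (x : ℝ × Ed d) (ξ : ℝ × Ed d), σ (x.1, x.2 + k) ξ = σ x ξ)
    (x x' : ℝ × Ed d) (k : Ed d) (hk : k ∈ Λ) :
    weylKernel d h σ (x.1, x.2 + k) x' = weylKernel d h σ x (x'.1, x'.2 + -k) := by
  unfold weylKernel
  congr 2
  ext ξ
  have h1 : ((x.1, x.2 + k) : ℝ × Ed d) - x' = x - (x'.1, x'.2 + -k) := by
    ext1
    · simp
    · simp only [Prod.snd_sub]; abel
  have h2 : (1 / 2 : ℝ) • (((x.1, x.2 + k) : ℝ × Ed d) + x') =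
      (((1 / 2 : ℝ) • (x + (x'.1, x'.2 + -k))).1, ((1 / 2 : ℝ) • (x + (x'.1, x'.2 + -k))).2 + k) := by
    ext1
    · simp
    · simp only [Prod.smul_snd, Prod.snd_add]
      module
  rw [h1, h2, hper k hk]

lemma tsum_symm (d : ℕ) (Λ : AddSubgroup (Ed d)) (h : ℝ) (σ : (ℝ × Ed d) → (ℝ × Ed d) → ℂ)
    (hper : ∀ k ∈ Λ, ∀ (x : ℝ × Ed d) (ξ : ℝ × Ed d), σ (x.1, x.2 + k) ξ = σ x ξ)
    (x x' : ℝ × Ed d) :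
    (starRingEnd ℂ) (∑' k : Λ, weylKernel d h (fun z ξ => (starRingEnd ℂ) (σ z ξ)) x'
      (x.1, x.2 + (k : Ed d))) = ∑' k : Λ, weylKernel d h σ x (x'.1, x'.2 + (k : Ed d)) := by
  rw [Complex.conj_tsum]
  simp_rw [weyl_conj]
  rw [← (Equiv.neg Λ).tsum_eq]
  refine tsum_congr fun k => ?_
  rw [weyl_shift d Λ h σ hper x x' _ (Equiv.neg Λ k).2]
  simp

lemma weight_symm (s y y' : ℝ) (hy : 0 < y) (hy' : 0 < y') :
    (y / y') ^ (s / 2) * y ^ (-s) = (y' / y) ^ (s / 2) * y' ^ (-s) := by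
  rw [Real.div_rpow hy.le hy'.le, Real.div_rpow hy'.le hy.le, Real.rpow_neg hy.le,
    Real.rpow_neg hy'.le]
  have h1 : y ^ s = y ^ (s / 2) * y ^ (s / 2) := by rw [← Real.rpow_add hy]; ring_nf
  have h2 : y' ^ s = y' ^ (s / 2) * y' ^ (s / 2) := by rw [← Real.rpow_add hy']; ring_nf
  have := Real.rpow_pos_of_pos hy (s / 2)
  have := Real.rpow_pos_of_pos hy' (s / 2)
  rw [h1, h2]
  field_simp

lemma weyl_meas (d : ℕ) (h : ℝ) (σ : (ℝ × Ed d) → (ℝ × Ed d) → ℂ)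
    (hmeas : Measurable fun p : (ℝ × Ed d) × (ℝ × Ed d) => σ p.1 p.2) :
    Measurable fun p : (ℝ × Ed d) × (ℝ × Ed d) => weylKernel d h σ p.1 p.2 := by
  unfold weylKernel
  have : Measurable fun q : ((ℝ × Ed d) × (ℝ × Ed d)) × (ℝ × Ed d) =>
      Complex.exp (Complex.I * Complex.ofReal (epair d (q.1.1 - q.1.2) q.2 / h)) *
        σ ((1 / 2 : ℝ) • (q.1.1 + q.1.2)) q.2 := by
    refine Measurable.mul (Continuous.measurable ?_) (hmeas.comp (g := fun p : (ℝ × Ed d) × (ℝ × Ed d) => σ p.1 p.2) (f := fun q : ((ℝ × Ed d) × (ℝ × Ed d)) × (ℝ × Ed d) => ((1 / 2 : ℝ) • (q.1.1 + q.1.2), q.2)) (Continuous.measurable ?_))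
    · unfold epair; fun_prop
    · fun_prop
  exact (this.stronglyMeasurable.integral_prod_right' (ν := volume)).measurable.const_smul
    (((2 * π * h) ^ (d + 1))⁻¹)

lemma fubini_finite (d : ℕ) (Λ : AddSubgroup (Ed d)) (hc : Countable Λ)
    (D : Set (Ed d)) (hD : IsAddFundamentalDomain Λ D volume) (hDvol : volume D = 1)
    (T : ℝ → ℝ≥0∞) (hT : Measurable T) (hTf : ∫⁻ y, T y < ⊤)
    (ψ : Ed d → ℝ≥0∞) (hψ : Measurable ψ) (hψf : ∫⁻ u, ψ u < ⊤) :
    ∫⁻ p, (∑' k : Λ, T p.1.1 * (T p.2.1 * ψ (p.1.2 - (p.2.2 + (k : Ed d)))))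
      ∂((volume.restrict (cusp d D)).prod (volume.restrict (cusp d D))) < ⊤ := by
  have hμ : volume.restrict (cusp d D) = ((volume : Measure ℝ).restrict (Set.Ioi 0)).prod
      ((volume : Measure (Ed d)).restrict D) := by
    rw [Measure.prod_restrict, ← Measure.volume_eq_prod]; rfl
  have hin : ∀ x : ℝ × Ed d, ∫⁻ x' in cusp d D, (∑' k : Λ, T x.1 * (T x'.1 * ψ (x.2 - (x'.2 + (k : Ed d)))))
      = T x.1 * ((∫⁻ y in Set.Ioi (0:ℝ), T y) * ∫⁻ u, ψ u) := by
    intro x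
    simp_rw [ENNReal.tsum_mul_left]
    rw [lintegral_const_mul _ (by fun_prop), hμ]
    rw [lintegral_prod_mul (f := T) (g := fun θ => ∑' k : Λ, ψ (x.2 - (θ + (k : Ed d))))
      hT.aemeasurable (by fun_prop)]
    rw [lintegral_tsum (fun k => by fun_prop)]
    congr 2
    rw [← lintegral_sub_left_eq_self ψ x.2, hD.lintegral_eq_tsum'']
    simp only [AddSubgroup.vadd_def, vadd_eq_add, add_comm]
  rw [lintegral_prod _ (by fun_prop)]
  simp_rw [hin]
  rw [lintegral_mul_const _ (by fun_prop), hμ]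
  have := lintegral_prod_mul (μ := (volume : Measure ℝ).restrict (Set.Ioi 0))
    (ν := (volume : Measure (Ed d)).restrict D) (f := T) (g := fun _ => 1) hT.aemeasurable
    (by fun_prop)
  simp only [mul_one, lintegral_one, Measure.restrict_apply_univ, hDvol] at this
  rw [this]
  have h2 : ∫⁻ y in Set.Ioi (0:ℝ), T y < ⊤ := (setLIntegral_le_lintegral _ _).trans_lt hTf
  exact ENNReal.mul_lt_top h2 (ENNReal.mul_lt_top h2 hψf)

lemma cusp_integrable (d : ℕ) (Λ : AddSubgroup (Ed d)) (hΛ : DiscreteTopology Λ)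
    (D : Set (Ed d)) (hD : IsAddFundamentalDomain Λ D volume) (hDvol : volume D = 1)
    (σ : (ℝ × Ed d) → (ℝ × Ed d) → ℂ)
    (hmeas : Measurable fun p : (ℝ × Ed d) × (ℝ × Ed d) => σ p.1 p.2)
    (hreg : ∀ (x : ℝ × Ed d) (Y : ℝ), ContDiff ℝ (d + 2) fun J : Ed d => σ x (Y, J))
    (C : ℝ)
    (hbound : ∀ m : ℕ, m ≤ d + 2 → ∀ x : ℝ × Ed d, 0 < x.1 → ∀ (Y : ℝ) (J : Ed d),
      ‖iteratedFDeriv ℝ m (fun J : Ed d => σ x (Y, J)) J‖ ≤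
        C * x.1 ^ (-(m : ℝ)) * (1 + x.1 * xiNorm d (Y, J)) ^ (-((d : ℝ) + 2)))
    (h : ℝ) (hh : 0 < h)
    (f g : ℝ × Ed d → ℂ)
    (hf : Continuous f)
    (hfper : ∀ k ∈ Λ, ∀ x : ℝ × Ed d, f (x.1, x.2 + k) = f x)
    (hfsupp : ∃ c₁ c₂ : ℝ, 0 < c₁ ∧ ∀ x : ℝ × Ed d, x.1 < c₁ ∨ c₂ < x.1 → f x = 0)
    (hg : Continuous g)
    (hgper : ∀ k ∈ Λ, ∀ x : ℝ × Ed d, g (x.1, x.2 + k) = g x)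
    (hgsupp : ∃ c₁ c₂ : ℝ, 0 < c₁ ∧ ∀ x : ℝ × Ed d, x.1 < c₁ ∨ c₂ < x.1 → g x = 0) :
    Integrable (fun p : (ℝ × Ed d) × (ℝ × Ed d) => cuspKernel d Λ h σ p.1 p.2 * f p.2 *
      ((starRingEnd ℂ) (g p.1) * ((p.1.1 ^ (-((d : ℝ) + 1)) : ℝ) : ℂ)))
      ((volume.restrict (cusp d D)).prod (volume.restrict (cusp d D))) := by
  have hcount : Countable Λ := TopologicalSpace.separableSpace_iff_countable.1 inferInstance
  obtain ⟨a₁, b₁, ha₁, hfs⟩ := hfsupp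
  obtain ⟨a₂, b₂, ha₂, hgs⟩ := hgsupp
  obtain ⟨Mf, hMf0, hMf⟩ := per_bdd d Λ hΛ D hD hDvol f hf hfper a₁ b₁ hfs
  obtain ⟨Mg, hMg0, hMg⟩ := per_bdd d Λ hΛ D hD hDvol g hg hgper a₂ b₂ hgs
  set a := min a₁ a₂ with ha
  set b := max b₁ b₂ with hb
  have ha0 : 0 < a := lt_min ha₁ ha₂
  have hfz : ∀ x : ℝ × Ed d, x.1 ∉ Set.Icc a b → f x = 0 := by
    intro x hx
    apply hfs
    by_contra hcon
    push Not at hcon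
    exact hx ⟨(min_le_left _ _).trans hcon.1, hcon.2.trans (le_max_left _ _)⟩
  have hgz : ∀ x : ℝ × Ed d, x.1 ∉ Set.Icc a b → g x = 0 := by
    intro x hx
    apply hgs
    by_contra hcon
    push Not at hcon
    exact hx ⟨(min_le_right _ _).trans hcon.1, hcon.2.trans (le_max_right _ _)⟩
  obtain ⟨M, hM0, hM⟩ := weyl_decay d σ hmeas hreg C hbound h hh a ha0
  obtain ⟨Q, hQ⟩ := (isCompact_Icc.prod isCompact_Icc :
    IsCompact (Set.Icc a b ×ˢ Set.Icc a b)).exists_bound_of_continuousOn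
    (f := fun q : ℝ × ℝ => (q.1 / q.2) ^ (((d : ℝ) + 1) / 2) * q.1 ^ (-((d : ℝ) + 1))) (by
      refine ContinuousOn.mul ?_ ?_
      · refine ContinuousOn.rpow_const (ContinuousOn.div (by fun_prop) (by fun_prop) ?_) ?_
        · rintro q ⟨-, hq⟩
          exact (ha0.trans_le hq.1).ne'
        · rintro q ⟨hq1, hq2⟩
          exact Or.inl (div_pos (ha0.trans_le hq1.1) (ha0.trans_le hq2.1)).ne'
      · refine ContinuousOn.rpow_const (by fun_prop) ?_
        rintro q ⟨hq, -⟩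
        exact Or.inl (ha0.trans_le hq.1).ne')
  set N : ℝ := max Q 0 * M * Mf * Mg with hN
  have hN0 : 0 ≤ N := by positivity
  set H : Λ → (ℝ × Ed d) × (ℝ × Ed d) → ℂ := fun k p =>
    (((p.1.1 / p.2.1) ^ (((d : ℝ) + 1) / 2) : ℝ) : ℂ) *
      weylKernel d h σ p.1 (p.2.1, p.2.2 + (k : Ed d)) * f p.2 *
      ((starRingEnd ℂ) (g p.1) * ((p.1.1 ^ (-((d : ℝ) + 1)) : ℝ) : ℂ)) with hH
  have hsum : (fun p : (ℝ × Ed d) × (ℝ × Ed d) => cuspKernel d Λ h σ p.1 p.2 * f p.2 *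
      ((starRingEnd ℂ) (g p.1) * ((p.1.1 ^ (-((d : ℝ) + 1)) : ℝ) : ℂ))) =
      fun p => ∑' k : Λ, H k p := by
    ext p
    simp only [hH, tsum_mul_left, tsum_mul_right, cuspKernel, Complex.real_smul]
  have hHm : ∀ k, Measurable (H k) := by
    intro k
    have h1 : Measurable fun p : (ℝ × Ed d) × (ℝ × Ed d) =>
        weylKernel d h σ p.1 (p.2.1, p.2.2 + (k : Ed d)) :=
      (weyl_meas d h σ hmeas).comp (g := fun p : (ℝ × Ed d) × (ℝ × Ed d) => weylKernel d h σ p.1 p.2)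
        (f := fun p : (ℝ × Ed d) × (ℝ × Ed d) => (p.1, (p.2.1, p.2.2 + (k : Ed d)))) (by fun_prop)
    have hf' := hf.measurable
    have hg' : Measurable fun x => (starRingEnd ℂ) (g x) :=
      (Complex.continuous_conj.comp hg).measurable
    have h2 : Measurable fun p : (ℝ × Ed d) × (ℝ × Ed d) =>
        (((p.1.1 / p.2.1) ^ (((d : ℝ) + 1) / 2) : ℝ) : ℂ) :=
      Complex.measurable_ofReal.comp (by fun_prop)
    have h3 : Measurable fun p : (ℝ × Ed d) × (ℝ × Ed d) =>
        ((p.1.1 ^ (-((d : ℝ) + 1)) : ℝ) : ℂ) :=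
      Complex.measurable_ofReal.comp (by fun_prop)
    exact ((h2.mul h1).mul (hf'.comp measurable_snd)).mul ((hg'.comp measurable_fst).mul h3)
  rw [hsum]
  refine ⟨(Measurable.tsum hHm).aestronglyMeasurable, ?_⟩
  set T : ℝ → ℝ≥0∞ := Set.indicator (Set.Icc a b) 1 with hTdef
  have hT : Measurable T := measurable_one.indicator measurableSet_Icc
  set ψ : Ed d → ℝ≥0∞ := fun u => ENNReal.ofReal (N * (1 + ‖u‖) ^ (-((d : ℝ) + 1))) with hψdef
  have hψ : Measurable ψ := by fun_prop
  refine lt_of_le_of_lt (lintegral_mono fun p => ?_)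
    (fubini_finite d Λ hcount D hD hDvol T hT ?_ ψ hψ ?_)
  · refine enorm_tsum_le_tsum_enorm.trans (ENNReal.tsum_le_tsum fun k => ?_)
    by_cases hp1 : p.1.1 ∈ Set.Icc a b
    swap
    · simp [hH, hgz p.1 hp1]
    by_cases hp2 : p.2.1 ∈ Set.Icc a b
    swap
    · simp [hH, hfz p.2 hp2]
    simp only [hTdef, Set.indicator_of_mem hp1, Set.indicator_of_mem hp2, Pi.one_apply, one_mul]
    rw [hψdef, ← ofReal_norm_eq_enorm]
    apply ENNReal.ofReal_le_ofReal
    have hW := hM p.1 (p.2.1, p.2.2 + (k : Ed d)) hp1.1 hp2.1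
    have hq := (hQ (p.1.1, p.2.1) ⟨hp1, hp2⟩).trans (le_max_left Q 0)
    rw [norm_mul] at hq
    simp only [hH, norm_mul, Complex.norm_real, RCLike.norm_conj]
    calc _ = (‖(p.1.1 / p.2.1) ^ (((d : ℝ) + 1) / 2)‖ * ‖p.1.1 ^ (-((d : ℝ) + 1))‖) *
          ‖weylKernel d h σ p.1 (p.2.1, p.2.2 + (k : Ed d))‖ * ‖f p.2‖ * ‖g p.1‖ := by ring
      _ ≤ max Q 0 * (M * (1 + ‖p.1.2 - (p.2.2 + (k : Ed d))‖) ^ (-((d : ℝ) + 1))) * Mf * Mg := by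
          gcongr
          · exact hMf _
          · exact hMg _
      _ = _ := by rw [hN]; ring
  · rw [hTdef, lintegral_indicator_one measurableSet_Icc]
    simp
  · have hi : Integrable fun u : Ed d => N * (1 + ‖u‖) ^ (-((d : ℝ) + 1)) := by
      refine (integrable_one_add_norm ?_).const_mul N
      simp
    have := hi.lintegral_lt_top
    exact this

/-- **Formal adjoint of the cusp quantization.** For a symbol `σ` which is
`Λ`-periodic in `θ`, `C^{d+2}` in the `J`-variables with
`|∂_J^α σ| ≤ C y^{-|α|}(1+y|ξ|)^{-(d+2)}` for `|α| ≤ d+2`, one has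
`⟨Op_h(σ)f, g⟩ = ⟨f, Op_h(σ̄)g⟩` for all `f, g ∈ C_c^∞(Z_Λ)`; in particular, if `σ` is
real-valued then `Op_h(σ)` is symmetric on `C_c^∞(Z_Λ)`. -/
theorem stmt10 (d : ℕ) (hd : 1 ≤ d) (Λ : AddSubgroup (Ed d)) (hΛ : DiscreteTopology Λ)
    (D : Set (Ed d)) (hD : IsAddFundamentalDomain Λ D volume) (hDvol : volume D = 1)
    (σ : (ℝ × Ed d) → (ℝ × Ed d) → ℂ)
    (hmeas : Measurable fun p : (ℝ × Ed d) × (ℝ × Ed d) => σ p.1 p.2)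
    (hper : ∀ k ∈ Λ, ∀ (x : ℝ × Ed d) (ξ : ℝ × Ed d), σ (x.1, x.2 + k) ξ = σ x ξ)
    (hreg : ∀ (x : ℝ × Ed d) (Y : ℝ), ContDiff ℝ (d + 2) fun J : Ed d => σ x (Y, J))
    (C : ℝ)
    (hbound : ∀ m : ℕ, m ≤ d + 2 → ∀ x : ℝ × Ed d, 0 < x.1 → ∀ (Y : ℝ) (J : Ed d),
      ‖iteratedFDeriv ℝ m (fun J : Ed d => σ x (Y, J)) J‖ ≤
        C * x.1 ^ (-(m : ℝ)) * (1 + x.1 * xiNorm d (Y, J)) ^ (-((d : ℝ) + 2)))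
    (h : ℝ) (hh : 0 < h)
    (f g : ℝ × Ed d → ℂ)
    (hfreg : ContDiff ℝ (⊤ : ℕ∞) f)
    (hfper : ∀ k ∈ Λ, ∀ x : ℝ × Ed d, f (x.1, x.2 + k) = f x)
    (hfsupp : ∃ c₁ c₂ : ℝ, 0 < c₁ ∧ ∀ x : ℝ × Ed d, x.1 < c₁ ∨ c₂ < x.1 → f x = 0)
    (hgreg : ContDiff ℝ (⊤ : ℕ∞) g)
    (hgper : ∀ k ∈ Λ, ∀ x : ℝ × Ed d, g (x.1, x.2 + k) = g x)
    (hgsupp : ∃ c₁ c₂ : ℝ, 0 < c₁ ∧ ∀ x : ℝ × Ed d, x.1 < c₁ ∨ c₂ < x.1 → g x = 0) :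
    cuspInner d D (cuspOp d Λ D h σ f) g =
        cuspInner d D f (cuspOp d Λ D h (fun z ξ => (starRingEnd ℂ) (σ z ξ)) g) ∧
      ((∀ (z ξ : ℝ × Ed d), (σ z ξ).im = 0) →
        cuspInner d D (cuspOp d Λ D h σ f) g = cuspInner d D f (cuspOp d Λ D h σ g)) := by
  have hmain : cuspInner d D (cuspOp d Λ D h σ f) g =
        cuspInner d D f (cuspOp d Λ D h (fun z ξ => (starRingEnd ℂ) (σ z ξ)) g) := by
    have hIntg := cusp_integrable d Λ hΛ D hD hDvol σ hmeas hreg C hbound h hh f g hfreg.continuous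
      hfper hfsupp hgreg.continuous hgper hgsupp
    have hswap := integral_integral_swap (f := fun x x' : ℝ × Ed d =>
      cuspKernel d Λ h σ x x' * f x' *
      ((starRingEnd ℂ) (g x) * ((x.1 ^ (-((d : ℝ) + 1)) : ℝ) : ℂ))) hIntg
    have hL : cuspInner d D (cuspOp d Λ D h σ f) g = ∫ x in cusp d D, ∫ x' in cusp d D,
        cuspKernel d Λ h σ x x' * f x' *
        ((starRingEnd ℂ) (g x) * ((x.1 ^ (-((d : ℝ) + 1)) : ℝ) : ℂ)) := by
      unfold cuspInner cuspOp
      congr 1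
      ext x
      rw [integral_mul_const, mul_assoc]
    rw [hL, hswap]
    unfold cuspInner cuspOp
    congr 1
    ext x'
    rw [← integral_conj, ← integral_const_mul, ← integral_mul_const]
    congr 1
    ext x
    obtain ⟨a₁, b₁, ha₁, hfs⟩ := hfsupp
    obtain ⟨a₂, b₂, ha₂, hgs⟩ := hgsupp
    by_cases hx : x.1 < a₂
    · simp [hgs x (Or.inl hx)]
    by_cases hx' : x'.1 < a₁
    · simp [hfs x' (Or.inl hx')]
    push Not at hx hx'
    have hw := weight_symm ((d : ℝ) + 1) x.1 x'.1 (ha₂.trans_le hx) (ha₁.trans_le hx')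
    have hwC := congrArg Complex.ofReal hw
    simp only [Complex.ofReal_mul] at hwC
    unfold cuspKernel
    rw [Complex.real_smul, Complex.real_smul, map_mul, map_mul, Complex.conj_ofReal,
      tsum_symm d Λ h σ hper x x']
    linear_combination (f x' * (starRingEnd ℂ) (g x) *
      ∑' k : Λ, weylKernel d h σ x (x'.1, x'.2 + (k : Ed d))) * hwC
  refine ⟨hmain, fun hreal => ?_⟩
  have hσ : (fun z ξ => (starRingEnd ℂ) (σ z ξ)) = σ := by
    ext z ξ
    exact Complex.conj_eq_iff_im.2 (hreal z ξ)
  rw [hσ] at hmain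
  exact hmain
end
end

section
/- (Poincaré–Wirtinger inequality at the top of a cusp.) There exists a constant C = C(d,Λ) > 0 such that for every T > 0 and every f ∈ C_c^∞(Z_Λ) whose average over each torus slice vanishes (∫_{ℝᵈ/Λ} f(y,θ) dθ = 0 for every y > 0), one has ∫_{y>T} ∫_{ℝᵈ/Λ} |f(y,θ)|² y^{-(d+1)} dθ dy ≤ (C/T²) ∫_{y>T} ∫_{ℝᵈ/Λ} y² ( |∂_y f|² + |∂_θ f|² ) y^{-(d+1)} dθ dy; equivalently ‖1_{y>T} f‖_{L²(Z_Λ)} ≤ (C/T) ‖1_{y>T} |∇f|_g‖_{L²(Z_Λ)}, where |∇f|_g² = y²(|∂_y f|² + |∂_θ f|²) is the Riemannian gradient norm of the cusp metric. -/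
open MeasureTheory Real Filter
open scoped RealInnerProductSpace ENNReal NNReal Topology

noncomputable section

section helpers

open scoped Pointwise

variable {d : ℕ} {Λ : AddSubgroup (Ed d)} {D : Set (Ed d)}

lemma aux_countable (hΛ : DiscreteTopology Λ) : Countable Λ :=
  TopologicalSpace.separableSpace_iff_countable.mp inferInstance

lemma aux_translate (hD : IsAddFundamentalDomain Λ D volume) (h : Ed d) :
    IsAddFundamentalDomain Λ (h +ᵥ D) volume := by
  have : VAddCommClass (Ed d) Λ (Ed d) := ⟨fun a b c => by
    simp only [vadd_eq_add, AddSubgroup.vadd_def]; abel⟩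
  exact hD.vadd_of_comm h

lemma aux_lint (hc : Countable Λ) (hD : IsAddFundamentalDomain Λ D volume) (h : Ed d)
    (F : Ed d → ℝ≥0∞) (hF : ∀ k ∈ Λ, ∀ x, F (x + k) = F x) :
    ∫⁻ x in D, F (x + h) = ∫⁻ x in D, F x := by
  have h1 := (aux_translate hD h).setLIntegral_eq hD F
    (fun g x => by rw [AddSubgroup.vadd_def, vadd_eq_add, add_comm]; exact hF _ g.2 x)
  have h2 := (measurePreserving_vadd h (volume : Measure (Ed d))).setLIntegral_comp_emb
      (measurableEmbedding_const_vadd h) F D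
  rw [← h1, ← Set.image_vadd, ← h2]
  simp only [vadd_eq_add, add_comm]

lemma aux_int (hc : Countable Λ) (hD : IsAddFundamentalDomain Λ D volume) (h : Ed d)
    (F : Ed d → ℂ) (hF : ∀ k ∈ Λ, ∀ x, F (x + k) = F x) :
    ∫ x in D, F (x + h) = ∫ x in D, F x := by
  have h1 := (aux_translate hD h).setIntegral_eq hD (f := F)
    (fun g x => by rw [AddSubgroup.vadd_def, vadd_eq_add, add_comm]; exact hF _ g.2 x)
  rw [← h1, ← Set.image_vadd,
    (measurePreserving_vadd h (volume : Measure (Ed d))).setIntegral_image_emb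
      (measurableEmbedding_const_vadd h)]
  simp only [vadd_eq_add, add_comm]

lemma aux_span (hc : Countable Λ) (hD : IsAddFundamentalDomain Λ D volume)
    (hDvol : volume D = 1) : Submodule.span ℝ (Λ : Set (Ed d)) = ⊤ := by
  by_contra hne
  rw [← Submodule.orthogonal_eq_bot_iff] at hne
  obtain ⟨v, hv, hv0⟩ := Submodule.exists_mem_ne_zero_of_ne_bot hne
  have hinv : ∀ k ∈ Λ, ⟪v, k⟫ = 0 := fun k hk => by
    rw [real_inner_comm]
    exact hv k (Submodule.subset_span hk)
  set F : Ed d → ℝ≥0∞ := fun x => ENNReal.ofReal (Real.arctan ⟪v, x⟫ + 2)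
  have hpos : ∀ t : ℝ, 0 < Real.arctan t + 2 := fun t => by
    have := Real.neg_pi_div_two_lt_arctan t
    have := Real.pi_lt_four
    linarith
  have key := aux_lint hc hD v F (fun k hk x => by simp [F, inner_add_right, hinv k hk])
  have hlt : ∫⁻ x in D, F x < ∫⁻ x in D, F (x + v) := by
    apply lintegral_strict_mono
    · intro h0
      rw [Measure.restrict_eq_zero] at h0
      simp [h0] at hDvol
    · have : Continuous fun x : Ed d => Real.arctan ⟪v, x + v⟫ + 2 := by fun_prop
      exact this.measurable.ennreal_ofReal.aemeasurable
    · apply ne_of_lt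
      calc ∫⁻ x in D, F x ≤ ∫⁻ x in D, ENNReal.ofReal 4 := by
            apply lintegral_mono
            intro x
            apply ENNReal.ofReal_le_ofReal
            have := Real.arctan_lt_pi_div_two ⟪v, x⟫
            have := Real.pi_lt_four
            linarith
        _ < ⊤ := by simp [hDvol]
    · refine Filter.Eventually.of_forall fun x => ?_
      apply (ENNReal.ofReal_lt_ofReal_iff (hpos _)).2
      have : ⟪v, x⟫ < ⟪v, x + v⟫ := by
        rw [inner_add_right, real_inner_self_eq_norm_sq]
        have := norm_pos_iff.2 hv0
        nlinarith
      have := Real.arctan_strictMono this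
      linarith
  exact hlt.ne key.symm

lemma aux_bdd (hΛ : DiscreteTopology Λ) (hD : IsAddFundamentalDomain Λ D volume)
    (hDvol : volume D = 1) : ∃ (D' : Set (Ed d)) (R : ℝ), 0 < R ∧
      IsAddFundamentalDomain Λ D' volume ∧ (∀ x ∈ D', ‖x‖ ≤ R) ∧ MeasurableSet D' ∧
      volume D' = 1 ∧ ∀ x, ∃ k ∈ Λ, x + k ∈ D' := by
  have hc := aux_countable hΛ
  let L : Submodule ℤ (Ed d) := AddSubgroup.toIntSubmodule Λ
  have hdL : DiscreteTopology L := hΛ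
  have hL : IsZLattice ℝ L := ⟨aux_span hc hD hDvol⟩
  have := ZLattice.module_finite ℝ L
  have := ZLattice.module_free ℝ L
  let b := (Module.Free.chooseBasis ℤ L)
  have h1 : IsAddFundamentalDomain Λ (ZSpan.fundamentalDomain (b.ofZLatticeBasis ℝ L)) volume :=
    ZLattice.isAddFundamentalDomain b volume
  obtain ⟨R, hR⟩ := (ZSpan.fundamentalDomain_isBounded (b.ofZLatticeBasis ℝ L)).exists_norm_le
  refine ⟨_, max R 1, by positivity, h1, fun x hx => (hR x hx).trans (le_max_left _ _),
    ZSpan.fundamentalDomain_measurableSet _, by rw [← h1.measure_eq hD] at *; exact hDvol, ?_⟩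
  intro x
  obtain ⟨k, hk, -⟩ := ZSpan.exist_unique_vadd_mem_fundamentalDomain (b.ofZLatticeBasis ℝ L) x
  refine ⟨k, ?_, ?_⟩
  · have h2 : (k : Ed d) ∈ L := (Module.Basis.ofZLatticeBasis_span ℝ L b).le k.2
    exact h2
  · rw [add_comm]; exact hk

lemma aux_jensen {α : Type*} [MeasurableSpace α] (μ : Measure α) (hμ : μ Set.univ = 1)
    (F : α → ℝ≥0∞) (hF : AEMeasurable F μ) : (∫⁻ x, F x ∂μ) ^ 2 ≤ ∫⁻ x, F x ^ 2 ∂μ := by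
  have := ENNReal.lintegral_mul_le_Lp_mul_Lq μ Real.HolderConjugate.two_two hF
    (aemeasurable_const (b := (1 : ℝ≥0∞)))
  simp only [Pi.mul_apply, mul_one, ENNReal.one_rpow, lintegral_const, hμ] at this
  calc (∫⁻ x, F x ∂μ) ^ 2 ≤ ((∫⁻ a, F a ^ (2:ℝ) ∂μ) ^ (1 / (2:ℝ))) ^ 2 := by gcongr
    _ = _ := by
      rw [← ENNReal.rpow_natCast, ← ENNReal.rpow_mul]
      simp

lemma aux_opnorm (A : Ed d →L[ℝ] ℂ) (h : Ed d) {R : ℝ} (hR : ‖h‖ ≤ R) :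
    ‖A h‖ₑ ^ 2 ≤ ENNReal.ofReal (R ^ 2 * ∑ i : Fin d, ‖A (EuclideanSpace.single i (1 : ℝ))‖ ^ 2) := by
  rw [← ofReal_norm, ← ENNReal.ofReal_pow (norm_nonneg _)]
  apply ENNReal.ofReal_le_ofReal
  have h1 : A h = ∑ i, h i • A (EuclideanSpace.single i (1 : ℝ)) := by
    conv_lhs => rw [← (EuclideanSpace.basisFun (Fin d) ℝ).sum_repr h]
    simp [map_sum]
  have h2 : ‖A h‖ ≤ ∑ i, |h i| * ‖A (EuclideanSpace.single i (1 : ℝ))‖ := by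
    rw [h1]
    refine (norm_sum_le _ _).trans_eq ?_
    simp
  calc ‖A h‖ ^ 2 ≤ (∑ i, |h i| * ‖A (EuclideanSpace.single i (1 : ℝ))‖) ^ 2 := by gcongr
    _ ≤ (∑ i, |h i| ^ 2) * ∑ i, ‖A (EuclideanSpace.single i (1 : ℝ))‖ ^ 2 :=
      Finset.sum_mul_sq_le_sq_mul_sq _ _ _
    _ = ‖h‖ ^ 2 * ∑ i, ‖A (EuclideanSpace.single i (1 : ℝ))‖ ^ 2 := by
      rw [EuclideanSpace.norm_sq_eq]; rfl
    _ ≤ _ := by gcongr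

lemma aux_path (g : Ed d → ℂ) (hg : ContDiff ℝ 1 g) (x h : Ed d) {R : ℝ} (hR : ‖h‖ ≤ R) :
    ‖g x - g (x + h)‖ₑ ^ 2 ≤ ∫⁻ t in Set.Icc (0 : ℝ) 1, ENNReal.ofReal
      (R ^ 2 * ∑ i : Fin d, ‖fderiv ℝ g (x + t • h) (EuclideanSpace.single i (1 : ℝ))‖ ^ 2) := by
  have hp : ContDiff ℝ 1 (fun t : ℝ => g (x + t • h)) := by fun_prop
  have hder : ∀ t : ℝ, deriv (fun t : ℝ => g (x + t • h)) t = fderiv ℝ g (x + t • h) h := by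
    intro t
    have h1 : HasDerivAt (fun t : ℝ => x + t • h) h t := by
      simpa using ((hasDerivAt_id t).smul_const h).const_add x
    exact ((hg.differentiable one_ne_zero _).hasFDerivAt.comp_hasDerivAt t h1).deriv
  have h1 := enorm_sub_le_lintegral_deriv_of_contDiffOn_Icc (hp.contDiffOn (s := Set.Icc 0 1))
    zero_le_one
  simp only [one_smul, zero_smul, add_zero, hder] at h1
  rw [← enorm_neg, neg_sub]
  have hm : Continuous fun t : ℝ => fderiv ℝ g (x + t • h) h := by
    have := hg.continuous_fderiv one_ne_zero
    fun_prop
  calc ‖g (x + h) - g x‖ₑ ^ 2 ≤ (∫⁻ t in Set.Icc (0 : ℝ) 1, ‖fderiv ℝ g (x + t • h) h‖ₑ) ^ 2 := by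
        gcongr
    _ ≤ ∫⁻ t in Set.Icc (0 : ℝ) 1, ‖fderiv ℝ g (x + t • h) h‖ₑ ^ 2 :=
        aux_jensen _ (by simp) _ hm.enorm.aemeasurable
    _ ≤ _ := lintegral_mono fun t => aux_opnorm _ _ hR

lemma aux_fderiv_per {E : Type*} [NormedAddCommGroup E] [NormedSpace ℝ E] (g : E → ℂ) (k : E)
    (hk : ∀ x, g (x + k) = g x) (x : E) : fderiv ℝ g (x + k) = fderiv ℝ g x := by
  rw [← fderiv_comp_add_right]
  congr 1
  funext y
  exact hk y

lemma aux_slice (hc : Countable Λ) (hD : IsAddFundamentalDomain Λ D volume)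
    (hDvol : volume D = 1) {D' : Set (Ed d)} {R : ℝ} (hD' : IsAddFundamentalDomain Λ D' volume)
    (hR : ∀ x ∈ D', ‖x‖ ≤ R) (hm : MeasurableSet D') (hv : volume D' = 1)
    (g : Ed d → ℂ) (hg : ContDiff ℝ 1 g) (hper : ∀ k ∈ Λ, ∀ x, g (x + k) = g x)
    (hmean : ∫ x in D, g x = 0) :
    ∫⁻ x in D, ENNReal.ofReal (‖g x‖ ^ 2) ≤ ∫⁻ x in D, ENNReal.ofReal
      (R ^ 2 * ∑ i : Fin d, ‖fderiv ℝ g x (EuclideanSpace.single i (1 : ℝ))‖ ^ 2) := by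
  set G : Ed d → ℝ≥0∞ := fun x => ENNReal.ofReal
      (R ^ 2 * ∑ i : Fin d, ‖fderiv ℝ g x (EuclideanSpace.single i (1 : ℝ))‖ ^ 2) with hG
  have hfc := hg.continuous_fderiv one_ne_zero
  have hgc := hg.continuous
  have hGc : Continuous G := by
    apply ENNReal.continuous_ofReal.comp
    fun_prop
  have hGper : ∀ k ∈ Λ, ∀ x, G (x + k) = G x := fun k hk x => by
    simp only [hG, aux_fderiv_per g k (hper k hk)]
  have hsub : D' ⊆ Metric.closedBall 0 R := fun x hx => by simpa using hR x hx
  have hpt : ∀ x, ‖g x‖ₑ ^ 2 ≤ ∫⁻ h in D', ∫⁻ t in Set.Icc (0 : ℝ) 1, G (x + t • h) := by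
    intro x
    have h0 : ∫ h in D', g (x + h) = 0 := by
      simp_rw [add_comm x]
      rw [aux_int hc hD' x g hper, ← hmean]
      exact hD'.setIntegral_eq hD (fun k y => by
        rw [AddSubgroup.vadd_def, vadd_eq_add, add_comm]; exact hper _ k.2 y)
    have hi : IntegrableOn (fun h => g (x + h)) D' volume :=
      ((by fun_prop : Continuous fun h => g (x + h)).continuousOn.integrableOn_compact
        (isCompact_closedBall 0 R)).mono_set hsub
    have h1 : g x = ∫ h in D', (g x - g (x + h)) := by
      have hci : IntegrableOn (fun _ : Ed d => g x) D' volume := integrableOn_const (by simp [hv])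
      rw [integral_sub hci hi, h0]
      simp [hv, Measure.real]
    calc ‖g x‖ₑ ^ 2 = ‖∫ h in D', (g x - g (x + h))‖ₑ ^ 2 := by rw [← h1]
      _ ≤ (∫⁻ h in D', ‖g x - g (x + h)‖ₑ) ^ 2 := by
        gcongr; exact enorm_integral_le_lintegral_enorm _
      _ ≤ ∫⁻ h in D', ‖g x - g (x + h)‖ₑ ^ 2 := by
        apply aux_jensen _ (by simpa using hv)
        exact (by fun_prop : Continuous fun h => g x - g (x + h)).enorm.aemeasurable
      _ ≤ _ := by
        apply setLIntegral_mono' hm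
        intro h hh
        exact aux_path g hg x h (hR h hh)
  have : SFinite ((volume : Measure (Ed d)).restrict D) := inferInstance
  calc ∫⁻ x in D, ENNReal.ofReal (‖g x‖ ^ 2)
      ≤ ∫⁻ x in D, ∫⁻ h in D', ∫⁻ t in Set.Icc (0 : ℝ) 1, G (x + t • h) := by
        apply lintegral_mono
        intro x
        refine le_trans (le_of_eq ?_) (hpt x)
        rw [← ofReal_norm, ← ENNReal.ofReal_pow (norm_nonneg _)]
    _ = ∫⁻ h in D', ∫⁻ x in D, ∫⁻ t in Set.Icc (0 : ℝ) 1, G (x + t • h) := by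
        apply lintegral_lintegral_swap
        apply Measurable.aemeasurable
        apply Measurable.lintegral_prod_right' (f := fun q : (Ed d × Ed d) × ℝ => G (q.1.1 + q.2 • q.1.2))
        exact (by fun_prop : Continuous fun q : (Ed d × Ed d) × ℝ => G (q.1.1 + q.2 • q.1.2)).measurable
    _ = ∫⁻ h in D', ∫⁻ t in Set.Icc (0 : ℝ) 1, ∫⁻ x in D, G (x + t • h) := by
        congr 1
        funext h
        apply lintegral_lintegral_swap
        apply Measurable.aemeasurable
        exact (by fun_prop : Continuous fun q : Ed d × ℝ => G (q.1 + q.2 • h)).measurable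
    _ = ∫⁻ h in D', ∫⁻ t in Set.Icc (0 : ℝ) 1, ∫⁻ x in D, G x := by
        simp_rw [aux_lint hc hD _ G hGper]
    _ = ∫⁻ x in D, G x := by simp [hv]

end helpers

/-- **Poincaré–Wirtinger inequality at the top of a cusp.** There is a
constant `C = C(d,Λ) > 0` such that for every `T > 0` and every `f ∈ C_c^∞(Z_Λ)` whose
average over each torus slice vanishes,
`∫_{y>T} |f|² dvol ≤ (C/T²) ∫_{y>T} y²(|∂_y f|² + |∂_θ f|²) dvol`,
where `dvol = y^{-(d+1)} dy dθ`. -/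
theorem stmt16 (d : ℕ) (hd : 1 ≤ d) (Λ : AddSubgroup (Ed d)) (hΛ : DiscreteTopology Λ)
    (D : Set (Ed d)) (hD : IsAddFundamentalDomain Λ D volume) (hDvol : volume D = 1) :
    ∃ C : ℝ, 0 < C ∧ ∀ T : ℝ, 0 < T →
      ∀ f : ℝ × Ed d → ℂ,
        ContDiff ℝ (⊤ : ℕ∞) f →
        (∀ k ∈ Λ, ∀ x : ℝ × Ed d, f (x.1, x.2 + k) = f x) →
        (∃ c₁ c₂ : ℝ, 0 < c₁ ∧ ∀ x : ℝ × Ed d, x.1 < c₁ ∨ c₂ < x.1 → f x = 0) →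
        (∀ y : ℝ, 0 < y → (∫ θ in D, f (y, θ)) = 0) →
        (∫ x in Set.Ioi T ×ˢ D, ‖f x‖ ^ 2 * x.1 ^ (-((d : ℝ) + 1))) ≤
          (C / T ^ 2) *
            ∫ x in Set.Ioi T ×ˢ D,
              x.1 ^ 2 *
                  (‖fderiv ℝ f x ((1 : ℝ), (0 : Ed d))‖ ^ 2 +
                    ∑ i : Fin d,
                      ‖fderiv ℝ f x ((0 : ℝ), (EuclideanSpace.single i (1 : ℝ) : Ed d))‖ ^ 2) *
                x.1 ^ (-((d : ℝ) + 1)) := by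
  have hc := aux_countable hΛ
  obtain ⟨D', R, hR0, hD', hR, hm, hv, hcov⟩ := aux_bdd hΛ hD hDvol
  refine ⟨R ^ 2, by positivity, ?_⟩
  intro T hT f hf hper hsupp hmean
  obtain ⟨c₁, c₂, hc₁, hs⟩ := hsupp
  have hf1 : ContDiff ℝ 1 f := hf.of_le (by exact_mod_cast le_top)
  have hfc : Continuous (fderiv ℝ f) := hf1.continuous_fderiv one_ne_zero
  have hf0 := hf.continuous
  set H : ℝ × Ed d → ℝ := fun x => x.1 ^ 2 *
      (‖fderiv ℝ f x ((1 : ℝ), (0 : Ed d))‖ ^ 2 + ∑ i : Fin d,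
        ‖fderiv ℝ f x ((0 : ℝ), (EuclideanSpace.single i (1 : ℝ) : Ed d))‖ ^ 2) *
      x.1 ^ (-((d : ℝ) + 1)) with hH
  have hw : Measurable fun x : ℝ × Ed d => x.1 ^ (-((d : ℝ) + 1)) := by fun_prop
  have hHm : Measurable H := by
    refine Measurable.mul (Continuous.measurable ?_) hw
    fun_prop
  have hLm : Measurable fun x : ℝ × Ed d => ‖f x‖ ^ 2 * x.1 ^ (-((d : ℝ) + 1)) := by
    refine Measurable.mul (Continuous.measurable ?_) hw
    fun_prop
  have hz : ∀ x : ℝ × Ed d, x.1 < c₁ ∨ c₂ < x.1 → fderiv ℝ f x = 0 := by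
    intro x hx
    have hopen : IsOpen {x : ℝ × Ed d | x.1 < c₁ ∨ c₂ < x.1} :=
      (isOpen_lt continuous_fst continuous_const).union (isOpen_lt continuous_const continuous_fst)
    have : f =ᶠ[𝓝 x] fun _ => 0 := by
      filter_upwards [hopen.mem_nhds hx] with y hy using hs y hy
    rw [this.fderiv_eq]
    simp
  obtain ⟨M, hM0, hM⟩ : ∃ M : ℝ, 0 ≤ M ∧ ∀ x, ‖fderiv ℝ f x‖ ≤ M := by
    obtain ⟨M, hM⟩ := ((isCompact_Icc (a := c₁) (b := c₂)).prod
      (isCompact_closedBall (0 : Ed d) R)).exists_bound_of_continuousOn hfc.continuousOn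
    refine ⟨max M 0, le_max_right _ _, fun x => ?_⟩
    by_cases hx : x.1 < c₁ ∨ c₂ < x.1
    · rw [hz x hx]; simp
    · push Not at hx
      obtain ⟨k, hk, hxk⟩ := hcov x.2
      have h1 := aux_fderiv_per f ((0 : ℝ), k) (fun y => by
        have h2 := hper k hk y
        have h3 : y + ((0 : ℝ), k) = (y.1, y.2 + k) := by ext <;> simp
        rw [h3, h2]) x
      rw [← h1]
      refine (hM _ ⟨?_, ?_⟩).trans (le_max_left _ _)
      · simpa using hx
      · simpa using hR _ hxk
  have hHi : IntegrableOn H (Set.Ioi T ×ˢ D) := by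
    have hvol : (volume : Measure (ℝ × Ed d)) (Set.Ioc T c₂ ×ˢ D) < ⊤ := by
      rw [Measure.volume_eq_prod, Measure.prod_prod]
      simp [hDvol]
    have hind : Integrable ((Set.Iic c₂ ×ˢ (Set.univ : Set (Ed d))).indicator
        (fun _ => c₂ ^ 2 * (‖((1 : ℝ), (0 : Ed d))‖ ^ 2 * M ^ 2 + ∑ i : Fin d,
          (‖((0 : ℝ), (EuclideanSpace.single i (1 : ℝ) : Ed d))‖ ^ 2 * M ^ 2)) *
          T ^ (-((d : ℝ) + 1)))) (volume.restrict (Set.Ioi T ×ˢ D)) := by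
      have hms : MeasurableSet (Set.Iic c₂ ×ˢ (Set.univ : Set (Ed d))) :=
        measurableSet_Iic.prod MeasurableSet.univ
      rw [integrable_indicator_iff hms]
      refine integrableOn_const ?_ enorm_ne_top
      rw [Measure.restrict_apply hms, Set.prod_inter_prod, Set.univ_inter, Set.inter_comm,
        Set.Ioi_inter_Iic]
      exact hvol.ne
    refine hind.mono' hHm.aestronglyMeasurable ?_
    have hae : ∀ᵐ x ∂(volume.restrict (Set.Ioi T ×ˢ D) : Measure (ℝ × Ed d)), T < x.1 := by
      have h1 : ∀ᵐ x ∂(volume.restrict (Set.Ioi T ×ˢ (Set.univ : Set (Ed d))) :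
          Measure (ℝ × Ed d)), T < x.1 := by
        filter_upwards [ae_restrict_mem (measurableSet_Ioi.prod MeasurableSet.univ)] with x hx
        exact hx.1
      exact ae_restrict_of_ae_restrict_of_subset
        (Set.prod_mono_right (Set.subset_univ _)) h1
    filter_upwards [hae] with x hx
    have hx0 : 0 < x.1 := hT.trans hx
    have hop : ∀ v, ‖fderiv ℝ f x v‖ ^ 2 ≤ ‖v‖ ^ 2 * M ^ 2 := fun v => by
      rw [← mul_pow, mul_comm]
      gcongr
      exact ((fderiv ℝ f x).le_opNorm v).trans (by gcongr; exact hM x)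
    by_cases hx2 : x.1 ≤ c₂
    · have hmem : x ∈ (Set.Iic c₂ ×ˢ (Set.univ : Set (Ed d))) := ⟨hx2, trivial⟩
      rw [Set.indicator_of_mem hmem, Real.norm_of_nonneg (by simp only [hH]; positivity)]
      simp only [hH]
      have e1 : x.1 ^ (-((d : ℝ) + 1)) ≤ T ^ (-((d : ℝ) + 1)) :=
        Real.rpow_le_rpow_of_nonpos hT hx.le (by have : (0:ℝ) ≤ d := Nat.cast_nonneg d
                                                 linarith)
      have e2 : x.1 ^ 2 ≤ c₂ ^ 2 := by gcongr
      refine mul_le_mul (mul_le_mul e2 (add_le_add (hop _) (Finset.sum_le_sum fun i _ => hop _))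
        (by positivity) (by positivity)) e1 (by positivity) (by positivity)
    · have : x ∉ (Set.Iic c₂ ×ˢ (Set.univ : Set (Ed d))) := fun h => hx2 h.1
      rw [Set.indicator_of_notMem this]
      simp [hH, hz x (Or.inr (not_le.1 hx2))]
  have hkey : ∫⁻ x in Set.Ioi T ×ˢ D, ENNReal.ofReal (‖f x‖ ^ 2 * x.1 ^ (-((d : ℝ) + 1))) ≤
      ∫⁻ x in Set.Ioi T ×ˢ D, ENNReal.ofReal (R ^ 2 / T ^ 2 * H x) := by
    rw [Measure.volume_eq_prod, ← Measure.prod_restrict,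
      lintegral_prod _ hLm.ennreal_ofReal.aemeasurable,
      lintegral_prod _ (hHm.const_mul _).ennreal_ofReal.aemeasurable]
    apply setLIntegral_mono' measurableSet_Ioi
    intro y hy
    have hy : T < y := hy
    have hy0 : 0 < y := hT.trans hy
    have hgd : ContDiff ℝ 1 (fun θ : Ed d => f (y, θ)) := by fun_prop
    have hfd : ∀ θ v : Ed d, fderiv ℝ (fun θ : Ed d => f (y, θ)) θ v =
        fderiv ℝ f (y, θ) ((0 : ℝ), v) := by
      intro θ v
      have h1 := ((hf1.differentiable one_ne_zero (y, θ)).hasFDerivAt).comp θ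
        (hasFDerivAt_prodMk_right y θ)
      have h2 : HasFDerivAt (fun θ : Ed d => f (y, θ)) _ θ := h1
      rw [h2.fderiv]
      simp
    have hsl := aux_slice hc hD hDvol hD' hR hm hv (fun θ => f (y, θ)) hgd
      (fun k hk θ => hper k hk (y, θ)) (hmean y hy0)
    simp only [hfd] at hsl
    have hwp : 0 ≤ y ^ (-((d : ℝ) + 1)) := by positivity
    calc ∫⁻ θ in D, ENNReal.ofReal (‖f (y, θ)‖ ^ 2 * y ^ (-((d : ℝ) + 1)))
        = (∫⁻ θ in D, ENNReal.ofReal (‖f (y, θ)‖ ^ 2)) * ENNReal.ofReal (y ^ (-((d : ℝ) + 1))) := by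
          rw [← lintegral_mul_const' _ _ ENNReal.ofReal_ne_top]
          simp_rw [ENNReal.ofReal_mul (sq_nonneg _)]
      _ ≤ (∫⁻ θ in D, ENNReal.ofReal (R ^ 2 * ∑ i : Fin d,
            ‖fderiv ℝ f (y, θ) ((0 : ℝ), EuclideanSpace.single i (1 : ℝ))‖ ^ 2)) *
            ENNReal.ofReal (y ^ (-((d : ℝ) + 1))) := by gcongr
      _ ≤ ∫⁻ θ in D, ENNReal.ofReal (R ^ 2 / T ^ 2 * H (y, θ)) := by
          rw [← lintegral_mul_const' _ _ ENNReal.ofReal_ne_top]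
          apply lintegral_mono
          intro θ
          beta_reduce
          rw [← ENNReal.ofReal_mul (by positivity)]
          apply ENNReal.ofReal_le_ofReal
          simp only [hH]
          set S := ∑ i : Fin d,
            ‖fderiv ℝ f (y, θ) ((0 : ℝ), EuclideanSpace.single i (1 : ℝ))‖ ^ 2 with hS
          have hS0 : 0 ≤ S := by positivity
          set N := ‖fderiv ℝ f (y, θ) ((1 : ℝ), (0 : Ed d))‖ ^ 2 with hN
          have hN0 : 0 ≤ N := by positivity
          have h1 : 1 ≤ y ^ 2 / T ^ 2 := by
            rw [one_le_div (by positivity)]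
            gcongr
          calc R ^ 2 * S * y ^ (-((d : ℝ) + 1))
              = 1 * (R ^ 2 * S * y ^ (-((d : ℝ) + 1))) := by ring
            _ ≤ y ^ 2 / T ^ 2 * (R ^ 2 * (N + S) * y ^ (-((d : ℝ) + 1))) := by
              gcongr
              linarith
            _ = _ := by ring
  have hrhs : Integrable (fun x => R ^ 2 / T ^ 2 * H x) (volume.restrict (Set.Ioi T ×ˢ D)) :=
    hHi.const_mul _
  have hnn : ∀ᵐ x ∂(volume.restrict (Set.Ioi T ×ˢ D) : Measure (ℝ × Ed d)), 0 < x.1 := by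
    have h1 : ∀ᵐ x ∂(volume.restrict (Set.Ioi T ×ˢ (Set.univ : Set (Ed d))) :
        Measure (ℝ × Ed d)), 0 < x.1 := by
      filter_upwards [ae_restrict_mem (measurableSet_Ioi.prod MeasurableSet.univ)] with x hx
      exact hT.trans hx.1
    exact ae_restrict_of_ae_restrict_of_subset
      (Set.prod_mono_right (Set.subset_univ _)) h1
  rw [← integral_const_mul]
  rw [integral_eq_lintegral_of_nonneg_ae (by
      filter_upwards [hnn] with x hx
      simp only [Pi.zero_apply]
      positivity) hLm.aestronglyMeasurable,
    integral_eq_lintegral_of_nonneg_ae (by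
      filter_upwards [hnn] with x hx
      simp only [Pi.zero_apply]
      positivity) hrhs.aestronglyMeasurable]
  refine ENNReal.toReal_mono ?_ hkey
  exact hrhs.lintegral_lt_top.ne
end
end
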